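/- arXiv:0710.4264 — 5 statements merged into one kernel-verified Lean document; each statement's English description precedes it below -/
import Mathlib

section
/- Let ψ : ℕ → (0,∞) be a non-increasing function with ∑_{k=1}^∞ ψ(k) = ∞. Then the set W(ψ) := {α ∈ [0,1] : ‖qα‖ < ψ(q) for infinitely many q ∈ ℕ} has Lebesgue measure 1. -/
open MeasureTheory Set

/-- `nint ξ = min {|ξ - p| : p ∈ ℤ}`, the distance from `ξ` to the nearest integer. -/
noncomputable def nint (ξ : ℝ) : ℝ := ⨅ p : ℤ, |ξ - (p : ℝ)|

open Filter Metric Topology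

theorem nint_le_norm (t : ℝ) : nint t ≤ ‖(t : UnitAddCircle)‖ := by
  rw [UnitAddCircle.norm_eq]
  exact ciInf_le ⟨0, by rintro _ ⟨p, rfl⟩; exact abs_nonneg _⟩ (round t)

namespace UnitAddCircle

theorem volume_real_closedBall (x : UnitAddCircle) {ε : ℝ} (h₀ : 0 ≤ ε) (h₁ : 2 * ε ≤ 1) :
    volume.real (closedBall x ε) = 2 * ε := by
  rw [measureReal_def, AddCircle.volume_closedBall, min_eq_right h₁,
    ENNReal.toReal_ofReal (by positivity)]

theorem volume_real_closedBall_le (x : UnitAddCircle) {ε : ℝ} (h₀ : 0 ≤ ε) :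
    volume.real (closedBall x ε) ≤ 2 * ε := by
  rw [measureReal_def, AddCircle.volume_closedBall]
  exact ENNReal.toReal_le_of_le_ofReal (by positivity)
    (ENNReal.ofReal_le_ofReal (min_le_right _ _))

theorem volume_real_ball (x : UnitAddCircle) {ε : ℝ} (h₀ : 0 ≤ ε) (h₁ : 2 * ε ≤ 1) :
    volume.real (ball x ε) = 2 * ε := by
  rw [← volume_real_closedBall x h₀ h₁]
  exact measureReal_congr AddCircle.closedBall_ae_eq_ball.symm

theorem exists_nsmul_eq_zero_norm_sub_le (x : UnitAddCircle) {q : ℕ} (hq : 0 < q) :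
    ∃ y : UnitAddCircle, q • y = 0 ∧ ‖x - y‖ ≤ ‖q • x‖ / q := by
  have hq' : (0 : ℝ) < q := by exact_mod_cast hq
  obtain ⟨t, rfl⟩ := QuotientAddGroup.mk_surjective x
  refine ⟨((round (q * t) / q : ℝ) : UnitAddCircle), ?_, ?_⟩
  · rw [← AddCircle.coe_nsmul, nsmul_eq_mul, mul_div_cancel₀ _ hq'.ne']
    exact (AddCircle.coe_eq_zero_iff 1).2 ⟨round (q * t), by simp⟩
  · have h : ‖q • (QuotientAddGroup.mk t : UnitAddCircle)‖ = |q * t - round (q * t)| := by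
      rw [← UnitAddCircle.norm_eq, ← nsmul_eq_mul]; rfl
    rw [h]
    calc ‖((t - round (q * t) / q : ℝ) : UnitAddCircle)‖ ≤ |t - round (q * t) / q| :=
          QuotientAddGroup.norm_mk_le_norm
      _ = |q * t - round (q * t)| / q := by
          rw [← abs_of_pos hq', ← abs_div, abs_of_pos hq']
          congr 1
          field_simp

/-- The volume of the union of disjoint balls around a separated set. -/
theorem volume_real_biUnion_ball {S : Finset UnitAddCircle} {s : ℝ} (hs : 0 ≤ s) (hs₁ : s ≤ 1)
    (hsep : ∀ x ∈ S, ∀ y ∈ S, x ≠ y → s ≤ ‖x - y‖) :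
    volume.real (⋃ y ∈ S, ball y (s / 2)) = S.card * s := by
  rw [measureReal_biUnion_finset]
  · rw [Finset.sum_congr rfl fun y _ => volume_real_ball y (ε := s / 2) (by linarith) (by linarith)]
    simp only [Finset.sum_const, nsmul_eq_mul]
    ring
  · intro x hx y hy hxy
    exact ball_disjoint_ball (by rw [dist_eq_norm]; linarith [hsep x hx y hy hxy])
  · exact fun y _ => measurableSet_ball

theorem card_mul_le_one {S : Finset UnitAddCircle} {s : ℝ} (hs : 0 ≤ s) (hs₁ : s ≤ 1)
    (hsep : ∀ x ∈ S, ∀ y ∈ S, x ≠ y → s ≤ ‖x - y‖) : S.card * s ≤ 1 := by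
  rw [← volume_real_biUnion_ball hs hs₁ hsep]
  refine (measureReal_mono (subset_univ _)).trans ?_
  simp [measureReal_def]

theorem card_mul_le_of_subset_closedBall {S : Finset UnitAddCircle} {s R : ℝ} (hs : 0 ≤ s)
    (hs₁ : s ≤ 1) (hR : 0 ≤ R) (hsep : ∀ x ∈ S, ∀ y ∈ S, x ≠ y → s ≤ ‖x - y‖)
    (x : UnitAddCircle) (hS : ∀ y ∈ S, dist y x ≤ R) : S.card * s ≤ 2 * R + s := by
  rw [← volume_real_biUnion_ball hs hs₁ hsep]
  have hsub : ⋃ y ∈ S, ball y (s / 2) ⊆ closedBall x (R + s / 2) := by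
    refine iUnion₂_subset fun y hy => ball_subset_closedBall.trans ?_
    exact closedBall_subset_closedBall' (by linarith [hS y hy])
  linarith [measureReal_mono hsub (μ := volume), volume_real_closedBall_le x
    (ε := R + s / 2) (by linarith)]

/-- Points of the circle annihilated by some `q` with `M < q ≤ 4 * M`. -/
def torsionBand (M : ℕ) : Set UnitAddCircle := {y | ∃ q : ℕ, M < q ∧ q ≤ 4 * M ∧ q • y = 0}

theorem finite_torsionBand (M : ℕ) : (torsionBand M).Finite := by
  refine ((Finset.Ioc M (4 * M)).finite_toSet.biUnion (t := fun q => {y | q • y = 0})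
    fun q hq => AddCircle.finite_torsion 1 ?_).subset ?_
  · have := (Finset.mem_Ioc.1 hq).1
    omega
  · rintro y ⟨q, h₁, h₂, h⟩
    exact mem_biUnion (Finset.mem_coe.2 (Finset.mem_Ioc.2 ⟨h₁, h₂⟩)) h

theorem nsmul_mem_torsionBand {M : ℕ} {y : UnitAddCircle} (hy : y ∈ torsionBand M) (n : ℕ) :
    n • y ∈ torsionBand M := by
  obtain ⟨q, h₁, h₂, h⟩ := hy
  exact ⟨q, h₁, h₂, by rw [smul_comm, h, smul_zero]⟩

theorem le_norm_sub_of_mem_torsionBand {M : ℕ} {x y : UnitAddCircle}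
    (hx : x ∈ torsionBand M) (hy : y ∈ torsionBand M) (hxy : x ≠ y) :
    1 / (16 * (M : ℝ) ^ 2) ≤ ‖x - y‖ := by
  obtain ⟨q, hq₁, hq₂, hq⟩ := hx
  obtain ⟨q', hq₁', hq₂', hq'⟩ := hy
  have hM : 0 < M := by omega
  have hz : (q * q') • (x - y) = 0 := by
    rw [smul_sub, mul_comm, mul_smul, hq, mul_comm, mul_smul, hq', smul_zero, smul_zero, sub_zero]
  have hpos : 0 < q * q' := Nat.mul_pos (by omega) (by omega)
  have h₁ := AddCircle.le_add_order_smul_norm_of_isOfFinAddOrder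
    (isOfFinAddOrder_iff_nsmul_eq_zero.2 ⟨q * q', hpos, hz⟩) (sub_ne_zero.2 hxy)
  have h₂ : addOrderOf (x - y) ≤ 16 * M ^ 2 :=
    (Nat.le_of_dvd hpos (addOrderOf_dvd_iff_nsmul_eq_zero.2 hz)).trans
      ((Nat.mul_le_mul hq₂ hq₂').trans (by apply le_of_eq; ring))
  have h₃ : (addOrderOf (x - y) : ℝ) ≤ 16 * (M : ℝ) ^ 2 := by exact_mod_cast h₂
  rw [nsmul_eq_mul] at h₁
  have hM' : (0 : ℝ) < M := by exact_mod_cast hM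
  rw [div_le_iff₀ (by positivity), mul_comm]
  exact h₁.trans (by gcongr)

theorem card_le_of_subset_torsionBand {M : ℕ} (hM : 0 < M) {S : Finset UnitAddCircle}
    (hS : ↑S ⊆ torsionBand M) : (S.card : ℝ) ≤ 16 * (M : ℝ) ^ 2 := by
  have hM' : (1 : ℝ) ≤ M := by exact_mod_cast hM
  have h := card_mul_le_one (S := S) (s := 1 / (16 * (M : ℝ) ^ 2)) (by positivity)
    (by rw [div_le_one (by positivity)]; nlinarith)
    fun x hx y hy => le_norm_sub_of_mem_torsionBand (hS hx) (hS hy)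
  rwa [mul_one_div, div_le_one (by positivity)] at h

theorem card_le_of_subset_torsionBand_closedBall {M : ℕ} (hM : 0 < M) {S : Finset UnitAddCircle}
    (hS : ↑S ⊆ torsionBand M) {R : ℝ} (hR : 0 ≤ R) (x : UnitAddCircle)
    (hx : ∀ y ∈ S, dist y x ≤ R) : (S.card : ℝ) ≤ 32 * (M : ℝ) ^ 2 * R + 1 := by
  have hM' : (1 : ℝ) ≤ M := by exact_mod_cast hM
  have h := card_mul_le_of_subset_closedBall (S := S) (s := 1 / (16 * (M : ℝ) ^ 2)) (by positivity)
    (by rw [div_le_one (by positivity)]; nlinarith) hR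
    (fun x hx y hy => le_norm_sub_of_mem_torsionBand (hS hx) (hS hy)) x hx
  rw [mul_one_div, div_le_iff₀ (by positivity)] at h
  refine h.trans (le_of_eq ?_)
  field_simp
  ring

theorem volume_real_norm_nsmul_le {j : ℕ} (hj : 0 < j) {ε : ℝ} (hε : 0 ≤ ε) :
    volume.real {x : UnitAddCircle | ‖j • x‖ ≤ ε} ≤ 2 * ε := by
  have hmp : MeasurePreserving (fun y : UnitAddCircle => j • y) volume volume := by
    obtain rfl | hj' := (Nat.succ_le_of_lt hj).eq_or_lt
    · simpa using! MeasurePreserving.id (volume : Measure UnitAddCircle)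
    · exact (AddCircle.ergodic_nsmul hj').toMeasurePreserving
  have h := hmp.measureReal_preimage
    (measurableSet_closedBall (x := (0 : UnitAddCircle)) (ε := ε)).nullMeasurableSet
  refine le_trans (le_of_eq ?_) (volume_real_closedBall_le 0 hε)
  rw [← h]
  congr 1
  ext x
  simp

/-- By Dirichlet's theorem, the points of `torsionBand M` are numerous: the points with a good
approximation of denominator at most `M` fill at most half of the circle. -/
theorem sq_le_card_torsionBand {M : ℕ} (hM : 0 < M) :
    (M : ℝ) ^ 2 ≤ (finite_torsionBand M).toFinset.card := by
  have hM' : (0 : ℝ) < M := by exact_mod_cast hM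
  set P := (finite_torsionBand M).toFinset
  set U : Set UnitAddCircle := ⋃ j ∈ Finset.Icc 1 M, {x | ‖j • x‖ ≤ 1 / (4 * M)}
  set V : Set UnitAddCircle := ⋃ y ∈ P, closedBall y (1 / (4 * (M : ℝ) ^ 2))
  have hcover : (univ : Set UnitAddCircle) ⊆ U ∪ V := by
    intro x _
    obtain ⟨j, ⟨hj₁, hj₂⟩, hj⟩ := AddCircle.exists_norm_nsmul_le x (n := 4 * M) (by omega)
    replace hj : ‖j • x‖ ≤ 1 / (4 * M) := hj.trans (by push_cast; gcongr; linarith)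
    by_cases hjM : j ≤ M
    · exact Or.inl (mem_biUnion (Finset.mem_coe.2 (Finset.mem_Icc.2 ⟨hj₁, hjM⟩)) hj)
    · push Not at hjM
      obtain ⟨y, hy, hxy⟩ := exists_nsmul_eq_zero_norm_sub_le x hj₁
      refine Or.inr (mem_biUnion (x := y) ?_ ?_)
      · simpa [P] using ⟨j, hjM, hj₂, hy⟩
      · rw [mem_closedBall, dist_eq_norm]
        have hjM' : (M : ℝ) ≤ j := by exact_mod_cast hjM.le
        calc ‖x - y‖ ≤ ‖j • x‖ / j := hxy
          _ ≤ (1 / (4 * M)) / M := by gcongr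
          _ = 1 / (4 * (M : ℝ) ^ 2) := by field_simp
  have hU : volume.real U ≤ 1 / 2 := by
    calc volume.real U
        ≤ ∑ j ∈ Finset.Icc 1 M, volume.real {x : UnitAddCircle | ‖j • x‖ ≤ 1 / (4 * M)} :=
          measureReal_biUnion_finset_le _ _
      _ ≤ ∑ j ∈ Finset.Icc 1 M, 2 * (1 / (4 * (M : ℝ))) :=
          Finset.sum_le_sum fun j hj =>
            volume_real_norm_nsmul_le (Finset.mem_Icc.1 hj).1 (by positivity)
      _ = 1 / 2 := by
          simp only [Finset.sum_const, Nat.card_Icc, nsmul_eq_mul, Nat.add_sub_cancel]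
          field_simp
          norm_num
  have hV : volume.real V ≤ P.card * (1 / (2 * (M : ℝ) ^ 2)) := by
    calc volume.real V ≤ ∑ y ∈ P, volume.real (closedBall y (1 / (4 * (M : ℝ) ^ 2))) :=
          measureReal_biUnion_finset_le _ _
      _ ≤ ∑ y ∈ P, 2 * (1 / (4 * (M : ℝ) ^ 2)) :=
          Finset.sum_le_sum fun y _ => volume_real_closedBall_le y (by positivity)
      _ = P.card * (1 / (2 * (M : ℝ) ^ 2)) := by
          simp only [Finset.sum_const, nsmul_eq_mul]
          ring
  have h₁ : volume.real (univ : Set UnitAddCircle) = 1 := by simp [measureReal_def]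
  have h₂ := (measureReal_mono (μ := volume) hcover).trans (measureReal_union_le U V)
  have h₃ : 1 / 2 ≤ P.card * (1 / (2 * (M : ℝ) ^ 2)) := by linarith
  rw [mul_one_div, le_div_iff₀ (by positivity)] at h₃
  linarith

/-- A greedy choice of disjoint balls of radius `r k` around points of `torsionBand (16 ^ k)`,
`m ≤ k < m + i`, whose total radius is large. -/
theorem exists_disjoint_balls {r : ℕ → ℝ} (hr : ∀ k, 0 < r k)
    (hr' : ∀ k, 32 * ((16 : ℝ) ^ k) ^ 2 * r k ≤ 1) (m i : ℕ) :
    ∃ A : Finset (UnitAddCircle × ℝ),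
      (∀ p ∈ A, ∃ k, m ≤ k ∧ p.1 ∈ torsionBand (16 ^ k) ∧ p.2 = r k) ∧
      (A : Set (UnitAddCircle × ℝ)).PairwiseDisjoint (fun p => ball p.1 p.2) ∧
      (A.card : ℝ) ≤ ((16 : ℝ) ^ (m + i)) ^ 2 / 8 ∧
      min (1 / 128) (∑ k ∈ Finset.range i, ((16 : ℝ) ^ (m + k)) ^ 2 * r (m + k) / 2)
        ≤ ∑ p ∈ A, p.2 := by
  classical
  induction i with
  | zero => exact ⟨∅, by simp, by simp, by simp; positivity, by simp⟩
  | succ i ih =>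
    obtain ⟨A, hA, hdisj, hcard, hsum⟩ := ih
    have hpow : ((16 : ℝ) ^ (m + (i + 1))) ^ 2 = 256 * ((16 : ℝ) ^ (m + i)) ^ 2 := by ring
    have hQ : 0 < ((16 : ℝ) ^ (m + i)) ^ 2 := by positivity
    by_cases hbig : 1 / 128 ≤ ∑ p ∈ A, p.2
    · exact ⟨A, hA, hdisj, by rw [hpow]; linarith, (min_le_left _ _).trans hbig⟩
    push Not at hbig
    set n := m + i
    set Q := ((16 : ℝ) ^ n) ^ 2
    set P := (finite_torsionBand (16 ^ n)).toFinset
    have hPmem : ∀ y, y ∈ P ↔ y ∈ torsionBand (16 ^ n) := fun y => by simp [P]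
    have hA₀ : ∀ p ∈ A, 0 < p.2 := fun p hp => by
      obtain ⟨k, -, -, hk⟩ := hA p hp
      exact hk ▸ hr k
    set T := P.filter fun y => ∀ p ∈ A, p.2 + r n ≤ dist p.1 y
    set B := P.filter fun y => ¬ ∀ p ∈ A, p.2 + r n ≤ dist p.1 y
    have hTB : (T.card : ℝ) + B.card = P.card := by
      exact_mod_cast Finset.card_filter_add_card_filter_not _
    have hTP : ∀ y ∈ T, y ∈ torsionBand (16 ^ n) := fun y hy =>
      (hPmem y).1 (Finset.mem_filter.1 hy).1
    have hPlow : Q ≤ P.card := by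
      simpa [Q] using sq_le_card_torsionBand (M := 16 ^ n) (by positivity)
    have hTup : (T.card : ℝ) ≤ 16 * Q := by
      simpa [Q] using card_le_of_subset_torsionBand (M := 16 ^ n) (by positivity) hTP
    have hB : (B.card : ℝ) ≤ Q / 2 := by
      have hsub : B ⊆ A.biUnion fun p => P.filter fun y => dist y p.1 ≤ p.2 + r n := by
        intro y hy
        obtain ⟨hyP, hy⟩ := Finset.mem_filter.1 hy
        push Not at hy
        obtain ⟨p, hp, hpy⟩ := hy
        rw [dist_comm] at hpy
        exact Finset.mem_biUnion.2 ⟨p, hp, Finset.mem_filter.2 ⟨hyP, hpy.le⟩⟩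
      calc (B.card : ℝ)
          ≤ ∑ p ∈ A, ((P.filter fun y => dist y p.1 ≤ p.2 + r n).card : ℝ) := by
            exact_mod_cast (Finset.card_le_card hsub).trans Finset.card_biUnion_le
        _ ≤ ∑ p ∈ A, (32 * Q * (p.2 + r n) + 1) := by
            refine Finset.sum_le_sum fun p hp => ?_
            have := card_le_of_subset_torsionBand_closedBall (M := 16 ^ n) (by positivity)
              (S := P.filter fun y => dist y p.1 ≤ p.2 + r n)
              (fun y hy => (hPmem y).1 (Finset.mem_filter.1 hy).1) (R := p.2 + r n)
              (by linarith [hA₀ p hp, hr n]) p.1 fun y hy => (Finset.mem_filter.1 hy).2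
            simpa [Q] using this
        _ = 32 * Q * (∑ p ∈ A, p.2) + A.card * (32 * Q * r n + 1) := by
            simp only [mul_add, Finset.sum_add_distrib, ← Finset.mul_sum, Finset.sum_const,
              nsmul_eq_mul]
            ring
        _ ≤ 32 * Q * (1 / 128) + Q / 8 * (1 + 1) := by
            have := hr n
            gcongr
            linarith [hr' n]
        _ = Q / 2 := by ring
    have hnew : Disjoint A (T ×ˢ {r n}) := by
      rw [Finset.disjoint_left]
      rintro ⟨y, ρ⟩ hp hpT
      have hyT := (Finset.mem_product.1 hpT).1
      have := (Finset.mem_filter.1 hyT).2 _ hp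
      simp only [dist_self] at this
      linarith [hA₀ _ hp, hr n]
    refine ⟨A ∪ T ×ˢ {r n}, ?_, ?_, ?_, ?_⟩
    · intro p hp
      rcases Finset.mem_union.1 hp with hp | hp
      · exact hA p hp
      · obtain ⟨h₁, h₂⟩ := Finset.mem_product.1 hp
        exact ⟨n, Nat.le_add_right _ _, hTP _ h₁, Finset.mem_singleton.1 h₂⟩
    · rw [Finset.coe_union]
      refine (pairwiseDisjoint_union).2 ⟨hdisj, ?_, ?_⟩
      · rintro ⟨y, ρ⟩ hy ⟨z, ρ'⟩ hz hyz
        obtain ⟨hyT, hρ⟩ := Finset.mem_product.1 (Finset.mem_coe.1 hy)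
        obtain ⟨hzT, hρ'⟩ := Finset.mem_product.1 (Finset.mem_coe.1 hz)
        simp only [Finset.mem_singleton] at hρ hρ'
        subst hρ hρ'
        refine ball_disjoint_ball ?_
        rw [dist_eq_norm]
        refine le_trans ?_ (le_norm_sub_of_mem_torsionBand (hTP y hyT) (hTP z hzT)
          fun h => hyz (Prod.ext h rfl))
        push_cast
        rw [le_div_iff₀ (by positivity)]
        linarith [hr' n]
      · rintro p hp ⟨y, ρ⟩ hy -
        obtain ⟨hyT, hρ⟩ := Finset.mem_product.1 (Finset.mem_coe.1 hy)
        simp only [Finset.mem_singleton] at hρ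
        subst hρ
        exact ball_disjoint_ball ((Finset.mem_filter.1 hyT).2 p hp)
    · rw [Finset.card_union_of_disjoint hnew, Finset.card_product, Finset.card_singleton, hpow]
      push_cast
      linarith
    · rw [Finset.sum_union hnew, Finset.sum_product, Finset.sum_range_succ]
      simp only [Finset.sum_singleton, Finset.sum_const, nsmul_eq_mul]
      have hT : Q / 2 ≤ T.card := by linarith
      have hTr : Q / 2 * r n ≤ T.card * r n := mul_le_mul_of_nonneg_right hT (hr n).le
      refine (min_le_right _ _).trans ?_
      have : ∑ k ∈ Finset.range i, ((16 : ℝ) ^ (m + k)) ^ 2 * r (m + k) / 2 ≤ ∑ p ∈ A, p.2 := by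
        rcases min_le_iff.1 hsum with h | h
        · linarith
        · exact h
      linarith

theorem volume_real_iUnion_thickening_torsionBand_ge {r : ℕ → ℝ} (hr : ∀ k, 0 < r k)
    (hr' : ∀ k, 32 * ((16 : ℝ) ^ k) ^ 2 * r k ≤ 1)
    (hdiv : ¬ Summable fun k => ((16 : ℝ) ^ k) ^ 2 * r k) (m : ℕ) :
    1 / 64 ≤ volume.real (⋃ k ≥ m, thickening (r k) (torsionBand (16 ^ k))) := by
  have hdiv' : ¬ Summable fun k => ((16 : ℝ) ^ (m + k)) ^ 2 * r (m + k) / 2 := by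
    intro h
    refine hdiv ((summable_nat_add_iff m).1 ?_)
    refine (h.mul_left 2).congr fun k => ?_
    rw [add_comm k m]
    ring
  rw [not_summable_iff_tendsto_nat_atTop_of_nonneg
    fun k => by have := hr (m + k); positivity] at hdiv'
  obtain ⟨i, hi⟩ := (hdiv'.eventually_ge_atTop (1 / 128)).exists
  obtain ⟨A, hA, hdisj, -, hsum⟩ := exists_disjoint_balls hr hr' m i
  rw [min_eq_left hi] at hsum
  have hrad : ∀ p ∈ A, 0 ≤ p.2 ∧ 2 * p.2 ≤ 1 := by
    intro p hp
    obtain ⟨k, -, -, hk⟩ := hA p hp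
    have h₁ : (1 : ℝ) ≤ ((16 : ℝ) ^ k) ^ 2 := one_le_pow₀ (one_le_pow₀ (by norm_num))
    rw [hk]
    exact ⟨(hr k).le, by nlinarith [hr k, hr' k]⟩
  have hvol : volume.real (⋃ p ∈ A, ball p.1 p.2) = 2 * ∑ p ∈ A, p.2 := by
    rw [measureReal_biUnion_finset hdisj fun p _ => measurableSet_ball, Finset.mul_sum]
    exact Finset.sum_congr rfl fun p hp => volume_real_ball p.1 (hrad p hp).1 (hrad p hp).2
  calc (1 : ℝ) / 64 ≤ volume.real (⋃ p ∈ A, ball p.1 p.2) := by rw [hvol]; linarith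
    _ ≤ _ := by
      refine measureReal_mono (iUnion₂_subset fun p hp => ?_) (measure_ne_top _ _)
      obtain ⟨k, hk, hmem, hpk⟩ := hA p hp
      rw [hpk]
      exact (ball_subset_thickening hmem _).trans
        (subset_biUnion_of_mem (u := fun k => thickening (r k) (torsionBand (16 ^ k))) hk)

/-- A zero-one law for limsup sets of neighbourhoods of sets stable under doubling. -/
theorem limsup_thickening_ae_empty_or_univ {s : ℕ → Set UnitAddCircle}
    (hs : ∀ k, ∀ y ∈ s k, 2 • y ∈ s k) {r : ℕ → ℝ} (hr : Tendsto r atTop (𝓝 0)) :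
    (limsup (fun k => thickening (r k) (s k)) atTop : Set UnitAddCircle) =ᵐ[volume] (∅ : Set _) ∨
      (limsup (fun k => thickening (r k) (s k)) atTop : Set UnitAddCircle) =ᵐ[volume] univ := by
  have hE := blimsup_thickening_mul_ae_eq (volume : Measure UnitAddCircle) (fun _ => True) s
    (M := 2) two_pos r hr
  simp only [blimsup_true] at hE
  refine (AddCircle.ergodic_nsmul one_lt_two).ae_empty_or_univ_of_image_ae_le
    (MeasurableSet.measurableSet_limsup fun n => isOpen_thickening.measurableSet).nullMeasurableSet
    (EventuallyLE.trans_eq (LE.le.eventuallyLE ?_) hE)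
  rintro _ ⟨x, hx, rfl⟩
  rw [mem_limsup_iff_frequently_mem] at hx ⊢
  refine hx.mono fun k hk => ?_
  rw [mem_thickening_iff] at hk ⊢
  obtain ⟨y, hy, hxy⟩ := hk
  refine ⟨2 • y, hs k y hy, ?_⟩
  rw [dist_eq_norm] at hxy ⊢
  rw [← smul_sub]
  refine (norm_nsmul_le (n := 2)).trans_lt ?_
  push_cast
  linarith

theorem ae_mem_limsup_thickening_torsionBand {r : ℕ → ℝ} (hr : ∀ k, 0 < r k)
    (hr' : ∀ k, 32 * ((16 : ℝ) ^ k) ^ 2 * r k ≤ 1)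
    (hdiv : ¬ Summable fun k => ((16 : ℝ) ^ k) ^ 2 * r k) :
    ∀ᵐ x : UnitAddCircle, x ∈ limsup (fun k => thickening (r k) (torsionBand (16 ^ k))) atTop := by
  have hr₀ : Tendsto r atTop (𝓝 0) := by
    refine squeeze_zero (fun k => (hr k).le) (fun k => ?_)
      (tendsto_pow_atTop_nhds_zero_of_lt_one (r := (1 / 16 : ℝ)) (by norm_num) (by norm_num))
    rw [one_div_pow, le_div_iff₀ (by positivity)]
    have h₁ : (1 : ℝ) ≤ (16 : ℝ) ^ k := one_le_pow₀ (by norm_num)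
    nlinarith [hr k, hr' k, mul_pos (hr k) (show (0 : ℝ) < 16 ^ k by positivity)]
  rcases limsup_thickening_ae_empty_or_univ
    (fun k y hy => nsmul_mem_torsionBand (M := 16 ^ k) hy 2) hr₀ with h | h
  · exfalso
    rw [limsup_eq_iInf_iSup_of_nat] at h
    simp only [iInf_eq_iInter, iSup_eq_iUnion] at h
    set U : ℕ → Set UnitAddCircle := fun m => ⋃ k ≥ m, thickening (r k) (torsionBand (16 ^ k))
    have hlim : Tendsto (volume ∘ U) atTop (𝓝 (volume (⋂ m, U m))) :=
      tendsto_measure_iInter_atTop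
        (fun m => (isOpen_biUnion fun _ _ => isOpen_thickening).measurableSet.nullMeasurableSet)
        (fun a b hab => biUnion_subset_biUnion_left fun k hk => hab.trans hk)
        ⟨0, measure_ne_top _ _⟩
    have hge : ENNReal.ofReal (1 / 64) ≤ volume (⋂ m, U m) := by
      refine ge_of_tendsto' hlim fun m => ?_
      exact ENNReal.ofReal_le_of_le_toReal
        (volume_real_iUnion_thickening_torsionBand_ge hr hr' hdiv m)
    rw [measure_congr h, measure_empty] at hge
    norm_num at hge
  · exact eventuallyEq_univ.1 h

end UnitAddCircle

theorem not_summable_min_const {a : ℕ → ℝ} {c : ℝ} (hc : 0 < c) (ha : ¬ Summable a) :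
    ¬ Summable fun k => min (a k) c := by
  intro h
  refine ha (h.congr_atTop ?_)
  filter_upwards [h.tendsto_atTop_zero.eventually_lt_const hc] with k hk
  rcases min_lt_iff.1 hk with h | h
  · exact min_eq_left h.le
  · exact absurd h (lt_irrefl c)

theorem not_summable_sixteen_pow_mul {ψ : ℕ → ℝ} (hψ : ∀ q, 0 < ψ q) (hmono : Antitone ψ)
    (hdiv : ¬ Summable ψ) : ¬ Summable fun k => (16 : ℝ) ^ k * ψ (4 * 16 ^ k) := by
  intro h
  refine hdiv ((summable_schlomilch_iff_of_nonneg (C := 16) (u := fun k => 4 * 16 ^ k)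
    (fun n => (hψ n).le) (fun _ _ _ hmn => hmono hmn) (fun n => by positivity) ?_ (by norm_num)
    ?_).1 ((h.mul_left 60).congr fun k => ?_))
  · exact fun a b hab => Nat.mul_lt_mul_of_pos_left (Nat.pow_lt_pow_right (by norm_num) hab)
      (by norm_num)
  · intro n
    simp only [pow_succ, smul_eq_mul]
    omega
  · push_cast
    ring

/-- **Khintchine's theorem, divergence case**: if `ψ : ℕ → (0,∞)` is
non-increasing and `∑ ψ(k) = ∞`, then the set `W(ψ)` of `α ∈ [0,1]` with
`‖qα‖ < ψ(q)` for infinitely many positive integers `q` has Lebesgue measure 1. -/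
theorem khintchine_divergence (ψ : ℕ → ℝ) (hψ : ∀ q, 0 < ψ q)
    (hmono : Antitone ψ) (hdiv : ¬ Summable ψ) :
    volume {α : ℝ | α ∈ Icc (0 : ℝ) 1 ∧
      {q : ℕ | 0 < q ∧ nint ((q : ℝ) * α) < ψ q}.Infinite} = 1 := by
  set r : ℕ → ℝ := fun k =>
    min (16 ^ k * ψ (4 * 16 ^ k) / 4) (1 / 32) / ((16 : ℝ) ^ k) ^ 2
  have hr : ∀ k, 0 < r k := fun k => by
    have := hψ (4 * 16 ^ k)
    positivity
  have hmul : ∀ k, ((16 : ℝ) ^ k) ^ 2 * r k = min (16 ^ k * ψ (4 * 16 ^ k) / 4) (1 / 32) :=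
    fun k => mul_div_cancel₀ _ (by positivity)
  have hae : ∀ᵐ α : ℝ ∂(volume.restrict (Ioc 0 (0 + 1))), (α : UnitAddCircle) ∈
      limsup (fun k => thickening (r k) (UnitAddCircle.torsionBand (16 ^ k))) atTop := by
    refine (UnitAddCircle.measurePreserving_mk 0).quasiMeasurePreserving.ae
      (UnitAddCircle.ae_mem_limsup_thickening_torsionBand hr (fun k => ?_) ?_)
    · rw [mul_assoc, hmul]
      linarith [min_le_right (16 ^ k * ψ (4 * 16 ^ k) / 4) (1 / 32 : ℝ)]
    · simp_rw [hmul]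
      refine not_summable_min_const (by norm_num) fun h => ?_
      exact not_summable_sixteen_pow_mul hψ hmono hdiv ((h.mul_left 4).congr fun k => by ring)
  rw [zero_add, ae_restrict_iff' measurableSet_Ioc] at hae
  refine le_antisymm ((measure_mono fun α hα => hα.1).trans (by simp)) ?_
  calc (1 : ENNReal) = volume (Ioc (0 : ℝ) 1) := by simp
    _ ≤ volume {α : ℝ | α ∈ Icc (0 : ℝ) 1 ∧
        {q : ℕ | 0 < q ∧ nint ((q : ℝ) * α) < ψ q}.Infinite} := by
      refine measure_mono_ae ?_
      filter_upwards [hae] with α hα hα₁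
      refine ⟨Ioc_subset_Icc_self hα₁, infinite_of_forall_exists_gt fun N => ?_⟩
      obtain ⟨k, hkN, hk⟩ := frequently_atTop.1 (mem_limsup_iff_frequently_mem.1 (hα hα₁)) N
      obtain ⟨y, ⟨q, hq₁, hq₂, hqy⟩, hy⟩ := mem_thickening_iff.1 hk
      have hNq : N < q := hkN.trans_lt ((Nat.lt_pow_self (by norm_num)).trans hq₁)
      refine ⟨q, ⟨by omega, ?_⟩, hNq⟩
      have hq₀ : (0 : ℝ) < q := by exact_mod_cast (show 0 < q by omega)
      have hq₂' : (q : ℝ) ≤ 4 * 16 ^ k := by exact_mod_cast hq₂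
      have hM : (0 : ℝ) < 16 ^ k := by positivity
      rw [dist_eq_norm] at hy
      calc nint (q * α) ≤ ‖((q * α : ℝ) : UnitAddCircle)‖ := nint_le_norm _
        _ = ‖q • ((α : UnitAddCircle) - y)‖ := by
            rw [smul_sub, hqy, sub_zero, ← AddCircle.coe_nsmul, nsmul_eq_mul]
        _ ≤ q * ‖(α : UnitAddCircle) - y‖ := norm_nsmul_le
        _ < q * r k := by gcongr
        _ ≤ 4 * 16 ^ k * r k := by
            have := (hr k).le
            gcongr
        _ = 4 * (((16 : ℝ) ^ k) ^ 2 * r k) / 16 ^ k := by field_simp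
        _ ≤ 4 * (16 ^ k * ψ (4 * 16 ^ k) / 4) / 16 ^ k := by
            rw [hmul]
            gcongr
            exact min_le_left _ _
        _ = ψ (4 * 16 ^ k) := by field_simp
        _ ≤ ψ q := hmono hq₂
end

section
/- Let m, n ≥ 1 and let ψ : ℕ → (0,∞) satisfy ∑_{k=1}^∞ k^{m-1} ψ(k)^n < ∞. Then the set W(ψ; m, n) := {X ∈ [0,1]^{m×n} : ‖qX‖ < ψ(|q|) for infinitely many q ∈ ℤ^m \ {0}} has mn-dimensional Lebesgue measure zero. -/
open MeasureTheory Set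

/-- `‖u‖ = max_j dist(u_j, ℤ)` for `u ∈ ℝⁿ`. -/
noncomputable def supNint {n : ℕ} (u : Fin n → ℝ) : ℝ := ⨆ j, nint (u j)

/-- `|q| = max_i |q_i|`, the supremum norm of an integer vector. -/
def supNorm {m : ℕ} (q : Fin m → ℤ) : ℕ := Finset.univ.sup fun i => (q i).natAbs

/-- The set of `ψ`-approximable `m × n` matrices in the unit cube:
`‖qX‖ < ψ(|q|)` for infinitely many nonzero integer vectors `q ∈ ℤᵐ`. -/
def Wmn (m n : ℕ) (ψ : ℕ → ℝ) : Set (Fin m → Fin n → ℝ) :=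
  {X | (∀ i j, X i j ∈ Icc (0 : ℝ) 1) ∧
    {q : Fin m → ℤ | q ≠ 0 ∧
      supNint (fun j => ∑ i, (q i : ℝ) * X i j) < ψ (supNorm q)}.Infinite}

lemma norm_coe_unitAddCircle_le_nint (x : ℝ) : ‖(x : UnitAddCircle)‖ ≤ nint x := by
  rw [UnitAddCircle.norm_eq]
  exact le_ciInf fun p => round_le x p

lemma nint_le_supNint {n : ℕ} (u : Fin n → ℝ) (j : Fin n) : nint (u j) ≤ supNint u :=
  le_ciSup (f := fun j => nint (u j)) (Set.finite_range _).bddAbove j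

/-- The homomorphism `X ↦ qX` from the torus of `m × n` matrices to the `n`-dimensional torus. -/
noncomputable def torusForms {m n : ℕ} (q : Fin m → ℤ) :
    (Fin m → Fin n → UnitAddCircle) →+ (Fin n → UnitAddCircle) where
  toFun X := ∑ i, q i • X i
  map_zero' := by simp
  map_add' X Y := by simp [Finset.sum_add_distrib]

lemma torusForms_apply {m n : ℕ} (q : Fin m → ℤ) (X : Fin m → Fin n → UnitAddCircle) :
    torusForms q X = ∑ i, q i • X i := rfl

lemma continuous_torusForms {m n : ℕ} (q : Fin m → ℤ) :
    Continuous (torusForms (n := n) q) := by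
  simp only [funext (torusForms_apply (n := n) q)]
  fun_prop

lemma surjective_torusForms {m n : ℕ} {q : Fin m → ℤ} (hq : q ≠ 0) :
    Function.Surjective (torusForms (n := n) q) := by
  obtain ⟨i₀, hi₀⟩ := Function.ne_iff.mp hq
  intro x
  choose y hy using fun j => QuotientAddGroup.mk_surjective (x j)
  refine ⟨Pi.single i₀ fun j => ((y j / q i₀ : ℝ) : UnitAddCircle), ?_⟩
  rw [torusForms_apply, Finset.sum_eq_single i₀ (fun i _ hi => by simp [hi]) (by simp)]
  ext j
  rw [Pi.single_eq_same, Pi.smul_apply, ← hy j, ← AddCircle.coe_zsmul, zsmul_eq_mul,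
    mul_div_cancel₀ _ (by exact_mod_cast hi₀)]

lemma measurePreserving_torusForms {m n : ℕ} {q : Fin m → ℤ} (hq : q ≠ 0) :
    MeasurePreserving (torusForms (n := n) q) volume volume := by
  have hpi (k : ℕ) : (volume : Measure (Fin k → UnitAddCircle)).IsAddHaarMeasure :=
    Measure.pi.isAddHaarMeasure _
  have hpi₂ : (volume : Measure (Fin m → Fin n → UnitAddCircle)).IsAddHaarMeasure :=
    Measure.pi.isAddHaarMeasure _
  refine AddMonoidHom.measurePreserving (continuous_torusForms q) (surjective_torusForms hq) ?_
  simp only [volume_pi, Measure.pi_univ, UnitAddCircle.measure_univ, Finset.prod_const_one]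

lemma volume_torusForms_preimage_le {m n : ℕ} {q : Fin m → ℤ} (hq : q ≠ 0) (δ : ℝ) :
    volume (torusForms q ⁻¹' (univ.pi fun _ : Fin n => Metric.closedBall 0 δ)) ≤
      ENNReal.ofReal (2 * δ) ^ n := by
  rw [(measurePreserving_torusForms hq).measure_preimage
    (MeasurableSet.univ_pi fun _ => measurableSet_closedBall).nullMeasurableSet, volume_pi_pi]
  simp only [AddCircle.volume_closedBall, Finset.prod_const, Finset.card_univ, Fintype.card_fin]
  gcongr
  exact min_le_right _ _

lemma measurePreserving_coe_unitCube (m n : ℕ) :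
    MeasurePreserving (fun (X : Fin m → Fin n → ℝ) i j => (X i j : UnitAddCircle))
      (volume.restrict (univ.pi fun _ => univ.pi fun _ => Icc 0 1)) volume := by
  have h : MeasurePreserving ((↑) : ℝ → UnitAddCircle) (volume.restrict (Icc 0 1)) volume := by
    have := UnitAddCircle.measurePreserving_mk 0
    rwa [zero_add, Measure.restrict_congr_set Ioc_ae_eq_Icc] at this
  rw [volume_pi, Measure.restrict_pi_pi]
  simp only [volume_pi, Measure.restrict_pi_pi]
  exact measurePreserving_pi _ _ fun _ => measurePreserving_pi _ _ fun _ => h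

lemma natAbs_le_supNorm {m : ℕ} (q : Fin m → ℤ) (i : Fin m) : (q i).natAbs ≤ supNorm q :=
  Finset.le_sup (f := fun i => (q i).natAbs) (Finset.mem_univ i)

lemma supNorm_eq_zero {m : ℕ} {q : Fin m → ℤ} (h : supNorm q = 0) : q = 0 := by
  ext i
  have := natAbs_le_supNorm q i
  simp only [Pi.zero_apply]
  omega

lemma encard_supNorm_eq_le {m k : ℕ} (hm : 1 ≤ m) (hk : 1 ≤ k) :
    {q : Fin m → ℤ | supNorm q = k}.encard ≤ (m * (2 * 3 ^ (m - 1) * k ^ (m - 1)) : ℕ) := by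
  classical
  let B (i : Fin m) : Finset (Fin m → ℤ) :=
    Fintype.piFinset (Function.update (fun _ => Finset.Icc (-k : ℤ) k) i {(k : ℤ), -(k : ℤ)})
  have hB (i : Fin m) : (B i).card ≤ 2 * 3 ^ (m - 1) * k ^ (m - 1) := by
    have hcomp (j : Fin m) : (Function.update (fun _ => Finset.Icc (-k : ℤ) k) i
        {(k : ℤ), -(k : ℤ)} j).card = Function.update (fun _ => (Finset.Icc (-k : ℤ) k).card) i
        ({(k : ℤ), -(k : ℤ)} : Finset ℤ).card j := by
      by_cases h : j = i
      · subst h; simp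
      · simp [h]
    rw [Fintype.card_piFinset, Finset.prod_congr rfl fun j _ => hcomp j,
      Finset.prod_update_of_mem (Finset.mem_univ i), Finset.prod_const, mul_assoc, ← mul_pow]
    refine Nat.mul_le_mul Finset.card_le_two ?_
    rw [show (Finset.univ \ {i}).card = m - 1 by
      rw [Finset.card_sdiff_of_subset (Finset.subset_univ _)]; simp]
    gcongr
    rw [Int.card_Icc]
    omega
  have hsub : {q : Fin m → ℤ | supNorm q = k} ⊆ ((Finset.univ.biUnion B : Finset _) : Set _) := by
    rintro q rfl
    obtain ⟨i, -, hi⟩ := Finset.exists_mem_eq_sup Finset.univ ⟨⟨0, hm⟩, Finset.mem_univ _⟩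
      fun i => (q i).natAbs
    change supNorm q = _ at hi
    simp only [Finset.coe_biUnion, mem_iUnion, B]
    refine ⟨i, by simp, ?_⟩
    rw [Finset.mem_coe, Fintype.mem_piFinset]
    intro j
    by_cases h : j = i
    · subst h
      simp only [Function.update_self, Finset.mem_insert, Finset.mem_singleton]
      omega
    · have := natAbs_le_supNorm q j
      simp only [Function.update_of_ne h, Finset.mem_Icc]
      omega
  refine (encard_le_encard hsub).trans ?_
  rw [encard_coe_eq_coe_finsetCard, Nat.cast_le]
  simpa using Finset.card_biUnion_le_card_mul Finset.univ B _ fun i _ => hB i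

lemma tsum_comp_supNorm_le {m : ℕ} (hm : 1 ≤ m) {f : ℕ → ENNReal} (hf : f 0 = 0) :
    ∑' q : Fin m → ℤ, f (supNorm q) ≤
      ∑' k : ℕ, (m * (2 * 3 ^ (m - 1) * k ^ (m - 1)) : ℕ) * f k := by
  rw [← (Equiv.sigmaFiberEquiv (supNorm (m := m))).tsum_eq, ENNReal.tsum_sigma']
  refine ENNReal.tsum_le_tsum fun k => ?_
  have hfib (x : {q : Fin m → ℤ // supNorm q = k}) :
      f (supNorm (Equiv.sigmaFiberEquiv supNorm ⟨k, x⟩)) = f k := congrArg f x.2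
  simp only [hfib]
  rcases Nat.eq_zero_or_pos k with rfl | hk
  · simp [hf]
  rw [ENNReal.tsum_const]
  gcongr
  exact_mod_cast encard_supNorm_eq_le hm hk

/-- **Khintchine–Groshev theorem, convergence case**: if
`∑ k^{m-1} ψ(k)^n < ∞`, then `W(ψ; m, n)` has `mn`-dimensional Lebesgue
measure zero. -/
theorem khintchine_groshev_convergence (m n : ℕ) (hm : 1 ≤ m) (hn : 1 ≤ n)
    (ψ : ℕ → ℝ) (hψ : ∀ k, 0 < ψ k)
    (hsum : Summable fun k : ℕ => (k : ℝ) ^ (m - 1) * ψ k ^ n) :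
    volume (Wmn m n ψ) = 0 := by
  let A (q : Fin m → ℤ) : Set (Fin m → Fin n → UnitAddCircle) :=
    {X | q ≠ 0 ∧ torusForms q X ∈ univ.pi fun _ : Fin n => Metric.closedBall 0 (ψ (supNorm q))}
  let f (k : ℕ) : ENNReal := if k = 0 then 0 else ENNReal.ofReal (2 * ψ k) ^ n
  have hA (q : Fin m → ℤ) : volume (A q) ≤ f (supNorm q) := by
    by_cases hq : q = 0
    · simp [A, hq]
    · have h0 : supNorm q ≠ 0 := fun h => hq (supNorm_eq_zero h)
      simp only [f, h0, if_false]
      exact (measure_mono fun X (hX : X ∈ A q) => hX.2).trans (volume_torusForms_preimage_le hq _)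
  have hfin : ∑' q, volume (A q) ≠ ⊤ := by
    refine ne_top_of_le_ne_top (hsum.mul_left ((m * (2 * 3 ^ (m - 1)) : ℝ) * 2 ^ n)).tsum_ofReal_ne_top
      (((ENNReal.tsum_le_tsum hA).trans (tsum_comp_supNorm_le hm (by simp [f]))).trans
        (ENNReal.tsum_le_tsum fun k => ?_))
    by_cases hk : k = 0
    · simp [f, hk]
    · have := (hψ k).le
      simp only [f, hk, if_false]
      rw [← ENNReal.ofReal_natCast, ← ENNReal.ofReal_pow (by positivity),
        ← ENNReal.ofReal_mul (by positivity)]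
      refine ENNReal.ofReal_le_ofReal (le_of_eq ?_)
      push_cast
      ring
  have hcube := (measurePreserving_coe_unitCube m n).quasiMeasurePreserving.preimage_null
    (measure_limsup_cofinite_eq_zero hfin)
  rw [Measure.restrict_apply' (MeasurableSet.univ_pi fun _ =>
    MeasurableSet.univ_pi fun _ => measurableSet_Icc)] at hcube
  refine measure_mono_null (fun X hX => ?_) hcube
  refine ⟨?_, fun i _ j _ => hX.1 i j⟩
  rw [mem_preimage, Filter.cofinite.limsup_set_eq]
  refine hX.2.mono fun q hq => And.intro hq.1 fun j _ => ?_
  rw [mem_closedBall_zero_iff]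
  have hcoe : torusForms q (fun i j => (X i j : UnitAddCircle)) j =
      ((∑ i, (q i : ℝ) * X i j : ℝ) : UnitAddCircle) := by
    simp [torusForms_apply, ← zsmul_eq_mul]
  rw [hcoe]
  exact (norm_coe_unitAddCircle_le_nint _).trans ((nint_le_supNint _ j).trans hq.2.le)
end

section
/- Let m, n ≥ 1 and let ψ : ℕ → (0,∞) be non-increasing with ∑_{k=1}^∞ k^{m-1} ψ(k)^n = ∞. Then the set W(ψ; m, n) := {X ∈ [0,1]^{m×n} : ‖qX‖ < ψ(|q|) for infinitely many q ∈ ℤ^m \ {0}} has mn-dimensional Lebesgue measure 1. -/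
open MeasureTheory Set

/-- Second moment bound for a bounded nonnegative function supported in `U`. -/
theorem sq_integral_le_measureReal_mul {Ω : Type*} [MeasurableSpace Ω] (μ : Measure Ω)
    [IsFiniteMeasure μ] {S : Ω → ℝ} {U : Set Ω} (hU : MeasurableSet U)
    (hS : Integrable S μ) (hS2 : Integrable (fun x => S x ^ 2) μ)
    (hSU : ∀ x, x ∉ U → S x = 0) :
    (∫ x, S x ∂μ) ^ 2 ≤ μ.real U * ∫ x, S x ^ 2 ∂μ := by
  have key : ∀ l : ℝ, 0 ≤ μ.real U * (l * l) + (-2 * ∫ x, S x ∂μ) * l + ∫ x, S x ^ 2 ∂μ := by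
    intro l
    have h1 : ∫ x, (S x - l * U.indicator 1 x) ^ 2 ∂μ
        = ∫ x, (S x ^ 2 + ((-2 * l) * S x + l * l * U.indicator (fun _ => (1 : ℝ)) x)) ∂μ := by
      refine integral_congr_ae (Filter.Eventually.of_forall fun x => ?_)
      by_cases hx : x ∈ U
      · simp [hx]; ring
      · simp [hx, hSU x hx]
    have hi : Integrable (U.indicator (fun _ => (1 : ℝ))) μ := (integrable_const 1).indicator hU
    have h2 : 0 ≤ ∫ x, (S x - l * U.indicator 1 x) ^ 2 ∂μ :=
      integral_nonneg fun x => sq_nonneg _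
    have hadd : Integrable (fun x => (-2 * l) * S x + l * l * U.indicator (fun _ => (1 : ℝ)) x) μ :=
      (hS.const_mul _).add (hi.const_mul _)
    rw [h1, integral_add hS2 hadd, integral_add (hS.const_mul _) (hi.const_mul _),
      integral_const_mul, integral_const_mul, integral_indicator_const _ hU] at h2
    simp only [smul_eq_mul, mul_one] at h2
    linarith
  have := discrim_le_zero key
  rw [discrim] at this
  nlinarith

theorem sum_half_pow_sub_le (K t L : ℕ) :
    ∑ s ∈ Finset.Ico K L, (if s ≤ t then (1 / 2 : ℝ) ^ (t - s) else 0) ≤ 2 := by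
  calc ∑ s ∈ Finset.Ico K L, (if s ≤ t then (1 / 2 : ℝ) ^ (t - s) else 0)
      = ∑ s ∈ (Finset.Ico K L).filter (· ≤ t), (1 / 2 : ℝ) ^ (t - s) := by
        rw [Finset.sum_filter]
    _ ≤ ∑ s ∈ Finset.range (t + 1), (1 / 2 : ℝ) ^ (t - s) := by
        refine Finset.sum_le_sum_of_subset_of_nonneg (fun s hs => ?_) fun _ _ _ => by positivity
        simp only [Finset.mem_filter] at hs
        simp; omega
    _ = ∑ s ∈ Finset.range (t + 1), (1 / 2 : ℝ) ^ s := by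
        rw [← Finset.sum_range_reflect]
        refine Finset.sum_congr rfl fun s hs => ?_
        simp at hs
        congr 1; omega
    _ ≤ 2 := by
        have := Summable.sum_le_tsum (Finset.range (t + 1))
          (fun i _ => by positivity) summable_geometric_two
        rwa [tsum_geometric_two] at this

/-- A quantitative second Borel–Cantelli lemma (of Kochen–Stone type): if the nonnegative functions
`f t` have divergent total mass and are quasi-independent on average, then the set of points where
infinitely many of them are positive has measure at least `C⁻¹`. -/
theorem inv_le_measureReal_frequently_pos {Ω : Type*} [MeasurableSpace Ω] (μ : Measure Ω)
    [IsFiniteMeasure μ] {f : ℕ → Ω → ℝ} (hf0 : ∀ t x, 0 ≤ f t x) (hfm : ∀ t, Measurable (f t))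
    (hfb : ∀ t, ∃ K, ∀ x, f t x ≤ K) {C D : ℝ} (hC : 0 < C) (hD : 0 ≤ D)
    (h : ∀ s t, s ≤ t → ∫ x, f s x * f t x ∂μ ≤
      C * ((∫ x, f s x ∂μ) * ∫ x, f t x ∂μ) + D * ((1 / 2) ^ (t - s) * ∫ x, f t x ∂μ))
    (hdiv : ¬ Summable fun t => ∫ x, f t x ∂μ) :
    C⁻¹ ≤ μ.real {x | ∃ᶠ t in Filter.atTop, 0 < f t x} := by
  choose B hB using hfb
  set a : ℕ → ℝ := fun t => ∫ x, f t x ∂μ with ha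
  have ha0 : ∀ t, 0 ≤ a t := fun t => integral_nonneg (hf0 t)
  have hfi : ∀ t, Integrable (f t) μ := fun t =>
    Integrable.of_bound (hfm t).aestronglyMeasurable (B t)
      (Filter.Eventually.of_forall fun x => by
        rw [Real.norm_eq_abs, abs_of_nonneg (hf0 t x)]; exact hB t x)
  have hffi : ∀ s t, Integrable (fun x => f s x * f t x) μ := fun s t =>
    Integrable.of_bound ((hfm s).mul (hfm t)).aestronglyMeasurable (B s * B t)
      (Filter.Eventually.of_forall fun x => by
        rw [Real.norm_eq_abs, abs_of_nonneg (mul_nonneg (hf0 s x) (hf0 t x))]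
        exact mul_le_mul (hB s x) (hB t x) (hf0 t x) ((hf0 s x).trans (hB s x)))
  let U : ℕ → Set Ω := fun K => {x | ∃ t ≥ K, 0 < f t x}
  have hUm : ∀ K, MeasurableSet (U K) := by
    intro K
    have : U K = ⋃ t ≥ K, {x | 0 < f t x} := by ext x; simp [U]
    rw [this]
    exact MeasurableSet.iUnion fun t => MeasurableSet.iUnion fun _ =>
      measurableSet_lt measurable_const (hfm t)
  have hpair : ∀ s t, ∫ x, f s x * f t x ∂μ ≤ C * (a s * a t) +
      D * ((if s ≤ t then (1 / 2) ^ (t - s) else 0) * a t +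
        (if t ≤ s then (1 / 2) ^ (s - t) else 0) * a s) := by
    intro s t
    have p : ∀ i j : ℕ, 0 ≤ (if i ≤ j then (1 / 2 : ℝ) ^ (j - i) else 0) := fun i j => by
      split_ifs <;> positivity
    rcases le_total s t with hst | hst
    · have := mul_nonneg hD (mul_nonneg (p t s) (ha0 s))
      refine (h s t hst).trans ?_
      rw [if_pos hst]
      linarith
    · have := mul_nonneg hD (mul_nonneg (p s t) (ha0 t))
      have h' := h t s hst
      simp_rw [mul_comm (f t _)] at h'
      refine h'.trans ?_
      rw [if_pos hst, mul_comm (a s)]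
      linarith
  have hU : ∀ K, C⁻¹ ≤ μ.real (U K) := by
    intro K
    have hfin : ∀ L, (∑ t ∈ Finset.Ico K L, a t) ^ 2 ≤ μ.real (U K) *
        (C * (∑ t ∈ Finset.Ico K L, a t) ^ 2 + 4 * D * ∑ t ∈ Finset.Ico K L, a t) := by
      intro L
      set T := Finset.Ico K L
      have hS2 : ∀ x, (∑ t ∈ T, f t x) ^ 2 = ∑ s ∈ T, ∑ t ∈ T, f s x * f t x := fun x => by
        rw [sq, Finset.sum_mul_sum]
      have hI2 : Integrable (fun x => (∑ t ∈ T, f t x) ^ 2) μ := by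
        simp_rw [hS2]
        exact integrable_finsetSum _ fun s _ => integrable_finsetSum _ fun t _ => hffi s t
      have h1 := sq_integral_le_measureReal_mul μ (hUm K) (S := fun x => ∑ t ∈ T, f t x)
        (integrable_finsetSum _ fun t _ => hfi t) hI2 (by
          intro x hx
          refine Finset.sum_eq_zero fun t ht => le_antisymm (not_lt.1 fun h0 => hx ?_) (hf0 t x)
          exact ⟨t, (Finset.mem_Ico.1 ht).1, h0⟩)
      rw [integral_finsetSum _ fun t _ => hfi t] at h1
      refine h1.trans (mul_le_mul_of_nonneg_left ?_ measureReal_nonneg)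
      simp_rw [hS2]
      rw [integral_finsetSum _ fun s _ => integrable_finsetSum _ fun t _ => hffi s t]
      simp_rw [fun s => integral_finsetSum T fun t _ => hffi s t]
      calc ∑ s ∈ T, ∑ t ∈ T, ∫ x, f s x * f t x ∂μ
          ≤ ∑ s ∈ T, ∑ t ∈ T, (C * (a s * a t) +
            D * ((if s ≤ t then (1 / 2) ^ (t - s) else 0) * a t +
              (if t ≤ s then (1 / 2) ^ (s - t) else 0) * a s)) :=
            Finset.sum_le_sum fun s _ => Finset.sum_le_sum fun t _ => hpair s t
        _ = C * (∑ t ∈ T, a t) ^ 2 +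
            2 * D * ∑ t ∈ T, (∑ s ∈ T, if s ≤ t then (1 / 2) ^ (t - s) else 0) * a t := by
            simp only [Finset.sum_add_distrib, ← Finset.mul_sum]
            rw [Finset.sum_comm
              (f := fun s t => (if s ≤ t then (1 / 2 : ℝ) ^ (t - s) else 0) * a t)]
            simp_rw [← Finset.sum_mul]
            ring
        _ ≤ C * (∑ t ∈ T, a t) ^ 2 + 2 * D * ∑ t ∈ T, 2 * a t := by
            gcongr with t _
            · exact ha0 t
            · exact sum_half_pow_sub_le K t L
        _ = _ := by rw [← Finset.mul_sum]; ring
    have hT : Filter.Tendsto (fun L => ∑ t ∈ Finset.range L, a (t + K)) Filter.atTop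
        Filter.atTop := by
      rw [← not_summable_iff_tendsto_nat_atTop_of_nonneg fun t => ha0 _]
      rwa [summable_nat_add_iff]
    have hbd : ∀ᶠ L in Filter.atTop, 1 ≤ μ.real (U K) *
        (C + 4 * D * (∑ t ∈ Finset.range L, a (t + K))⁻¹) := by
      filter_upwards [hT.eventually_gt_atTop 0] with L hL
      have h1 := hfin (K + L)
      rw [Finset.sum_Ico_eq_sum_range, Nat.add_sub_cancel_left] at h1
      simp_rw [add_comm K] at h1
      set A := ∑ t ∈ Finset.range L, a (t + K)
      have : μ.real (U K) * (C + 4 * D * A⁻¹) * A ^ 2 =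
        μ.real (U K) * (C * A ^ 2 + 4 * D * A) := by field_simp
      rw [← this] at h1
      by_contra! hlt
      nlinarith [pow_pos hL 2]
    have hlim : Filter.Tendsto (fun L => μ.real (U K) *
        (C + 4 * D * (∑ t ∈ Finset.range L, a (t + K))⁻¹)) Filter.atTop
        (nhds (μ.real (U K) * (C + 4 * D * 0))) :=
      ((hT.inv_tendsto_atTop.const_mul _).const_add _).const_mul _
    have := ge_of_tendsto hlim hbd
    rw [inv_le_iff_one_le_mul₀ hC]
    simpa using this
  have hset : {x | ∃ᶠ t in Filter.atTop, 0 < f t x} = ⋂ K, U K := by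
    ext x
    simp [U, Filter.frequently_atTop]
  rw [hset]
  have hanti : Antitone U := fun i j hij x ⟨t, ht, hx⟩ => ⟨t, hij.trans ht, hx⟩
  have := tendsto_measure_iInter_atTop (μ := μ) (fun K => (hUm K).nullMeasurableSet) hanti
    ⟨0, measure_ne_top _ _⟩
  have := (ENNReal.tendsto_toReal (measure_ne_top μ _)).comp this
  exact ge_of_tendsto' this hU

/-- Cauchy condensation to the base `b`. -/
theorem not_summable_condensed {b m n : ℕ} (hb : 2 ≤ b) (hm : 1 ≤ m) {φ : ℕ → ℝ}
    (hφ : ∀ k, 0 < φ k) (hmono : Antitone φ)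
    (hdiv : ¬ Summable fun k : ℕ => (k : ℝ) ^ (m - 1) * φ k ^ n) :
    ¬ Summable fun t : ℕ => ((b : ℝ) ^ t) ^ m * φ (b ^ t) ^ n := by
  intro h
  apply hdiv
  set g : ℕ → ℝ := fun k => (k : ℝ) ^ (m - 1) * φ k ^ n
  set c : ℕ → ℝ := fun t => ((b : ℝ) ^ t) ^ m * φ (b ^ t) ^ n
  have hg0 : ∀ k, 0 ≤ g k := fun k => mul_nonneg (by positivity) (pow_nonneg (hφ k).le _)
  have hc0 : ∀ k, 0 ≤ c k := fun k => mul_nonneg (by positivity) (pow_nonneg (hφ _).le _)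
  have hblock : ∀ t, ∑ k ∈ Finset.Ico (b ^ t) (b ^ (t + 1)), g k ≤ (b : ℝ) ^ m * c t := by
    intro t
    have h1 : ∀ k ∈ Finset.Ico (b ^ t) (b ^ (t + 1)),
        g k ≤ ((b : ℝ) ^ (t + 1)) ^ (m - 1) * φ (b ^ t) ^ n := by
      intro k hk
      rw [Finset.mem_Ico] at hk
      have : (k : ℝ) ≤ (b : ℝ) ^ (t + 1) := by exact_mod_cast hk.2.le
      exact mul_le_mul (pow_le_pow_left₀ (by positivity) this _)
        (pow_le_pow_left₀ (hφ k).le (hmono hk.1) _) (pow_nonneg (hφ k).le _) (by positivity)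
    refine (Finset.sum_le_card_nsmul _ _ _ h1).trans ?_
    rw [Nat.card_Ico, nsmul_eq_mul]
    have h2 : ((b ^ (t + 1) - b ^ t : ℕ) : ℝ) ≤ (b : ℝ) ^ (t + 1) := by
      exact_mod_cast Nat.sub_le _ _
    have h3 : 0 ≤ ((b : ℝ) ^ (t + 1)) ^ (m - 1) * φ (b ^ t) ^ n :=
      mul_nonneg (by positivity) (pow_nonneg (hφ _).le _)
    refine (mul_le_mul_of_nonneg_right h2 h3).trans_eq ?_
    obtain ⟨m, rfl⟩ := Nat.exists_eq_add_of_le' hm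
    simp only [c, Nat.add_sub_cancel]
    ring
  have hsum : ∀ T, ∑ k ∈ Finset.range (b ^ T), g k ≤ g 0 + b ^ m * ∑ t ∈ Finset.range T, c t := by
    intro T
    induction T with
    | zero => simp
    | succ T ih =>
      rw [← Finset.sum_range_add_sum_Ico _ (Nat.pow_le_pow_right (by omega) (Nat.le_succ T)),
        Finset.sum_range_succ]
      linarith [hblock T]
  refine summable_of_sum_range_le (c := g 0 + b ^ m * ∑' t, c t) hg0 fun N => ?_
  have hN : N ≤ b ^ N := (Nat.lt_pow_self (by omega)).le
  calc ∑ k ∈ Finset.range N, g k ≤ ∑ k ∈ Finset.range (b ^ N), g k :=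
        Finset.sum_le_sum_of_subset_of_nonneg (by simpa using hN) fun _ _ _ => hg0 _
    _ ≤ _ := hsum N
    _ ≤ _ := by
      gcongr
      exact h.sum_le_tsum _ fun _ _ => hc0 _

/-- Dirichlet's theorem on simultaneous approximation. -/
theorem exists_simultaneous_approx {n M : ℕ} (hM : 1 ≤ M) (x : Fin n → ℝ) :
    ∃ q : ℕ, 1 ≤ q ∧ q ≤ M ^ n ∧ ∃ p : Fin n → ℤ, ∀ i, |q * x i - p i| ≤ 1 / M := by
  have hM0 : (0 : ℝ) < M := by exact_mod_cast hM
  have hlt : ∀ y : ℝ, ⌊M * Int.fract y⌋₊ < M := fun y => by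
    rw [Nat.floor_lt (by positivity)]
    nlinarith [Int.fract_lt_one y]
  let F : ℕ → Fin n → Fin M := fun q i => ⟨⌊M * Int.fract (q * x i)⌋₊, hlt _⟩
  obtain ⟨q, hq, r, hr, hne, hF⟩ := Finset.exists_ne_map_eq_of_card_lt_of_maps_to
    (s := Finset.range (M ^ n + 1)) (t := Finset.univ) (f := F) (by simp) (by simp)
  wlog hlt' : q < r generalizing q r
  · exact this r hr q hq hne.symm hF.symm (by omega)
  refine ⟨r - q, by omega, by simp at hr; omega,
    fun i => ⌊r * x i⌋ - ⌊q * x i⌋, fun i => ?_⟩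
  have h1 : ⌊M * Int.fract (q * x i)⌋₊ = ⌊M * Int.fract (r * x i)⌋₊ := by
    have := congrFun hF i
    simpa [F] using this
  have h2 := Nat.floor_le (a := M * Int.fract (q * x i)) (by positivity)
  have h3 := Nat.floor_le (a := M * Int.fract (r * x i)) (by positivity)
  have h4 := Nat.lt_floor_add_one (M * Int.fract (q * x i))
  have h5 := Nat.lt_floor_add_one (M * Int.fract (r * x i))
  rw [h1] at h2 h4
  have habs : ∀ z : ℝ, |z| * M = |z * M| := fun z => by rw [abs_mul, abs_of_pos hM0]
  rw [le_div_iff₀ hM0, habs, abs_le]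
  push_cast [hlt'.le]
  simp only [Int.fract] at h2 h3 h4 h5
  constructor <;> linarith

/-- A finite subset of a finite set that is roughly `ρ`-dense in it and roughly `ρ`-separated. -/
theorem exists_subset_dense_separated {n : ℕ} (R : Finset (Fin n → ℝ)) {ρ : ℝ} (hρ : 0 < ρ) :
    ∃ P ⊆ R, (∀ y ∈ R, ∃ v ∈ P, dist y v ≤ ρ) ∧
      ∀ (S : Finset (Fin n → ℝ)) (u : Fin n → ℝ) (r : ℝ), 0 ≤ r → S ⊆ P →
        (∀ v ∈ S, dist v u ≤ r) → (S.card : ℝ) ≤ (2 * r / ρ + 2) ^ n := by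
  classical
  let c : (Fin n → ℝ) → Fin n → ℤ := fun y i => ⌊y i / ρ⌋
  obtain ⟨P, hPR, hinj, himg⟩ :=
    Finset.exists_subset_injOn_image_eq_of_surjOn (f := c) (s := (R : Set _))
    (R.image c) (by simpa using Set.surjOn_image c R)
  refine ⟨P, by exact_mod_cast hPR, fun y hy => ?_, fun S u r hr hSP hS => ?_⟩
  · have : c y ∈ P.image c := by rw [himg]; exact Finset.mem_image_of_mem _ hy
    obtain ⟨v, hv, hvy⟩ := Finset.mem_image.1 this
    refine ⟨v, hv, (dist_pi_le_iff hρ.le).2 fun i => ?_⟩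
    have h1 : ⌊v i / ρ⌋ = ⌊y i / ρ⌋ := congrFun hvy i
    have h2 := Int.abs_sub_lt_one_of_floor_eq_floor h1
    rw [Real.dist_eq, abs_sub_comm]
    rw [← sub_div, abs_div, abs_of_pos hρ, div_lt_one hρ] at h2
    exact h2.le
  · have h1 : S.card ≤ (Fintype.piFinset fun i =>
        Finset.Icc ⌊(u i - r) / ρ⌋ ⌊(u i + r) / ρ⌋).card := by
      rw [← Finset.card_image_of_injOn (f := c) (s := S) (hinj.mono (by exact_mod_cast hSP))]
      refine Finset.card_le_card fun z hz => ?_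
      obtain ⟨v, hv, rfl⟩ := Finset.mem_image.1 hz
      rw [Fintype.mem_piFinset]
      intro i
      have h2 := (dist_pi_le_iff hr).1 (hS v hv) i
      rw [Real.dist_eq, abs_le] at h2
      rw [Finset.mem_Icc]
      constructor
      · apply Int.floor_le_floor
        gcongr
        linarith
      · apply Int.floor_le_floor
        gcongr
        linarith
    rw [Fintype.card_piFinset] at h1
    calc (S.card : ℝ) ≤ ∏ i, ((Finset.Icc ⌊(u i - r) / ρ⌋ ⌊(u i + r) / ρ⌋).card : ℝ) := by
          exact_mod_cast h1
      _ ≤ ∏ i : Fin n, (2 * r / ρ + 2) := by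
          refine Finset.prod_le_prod (fun _ _ => by positivity) fun i _ => ?_
          rw [Int.card_Icc]
          have hle : ⌊(u i - r) / ρ⌋ ≤ ⌊(u i + r) / ρ⌋ := by
            apply Int.floor_le_floor
            gcongr
            linarith
          have h3 : (((⌊(u i + r) / ρ⌋ + 1 - ⌊(u i - r) / ρ⌋).toNat : ℕ) : ℝ) =
              ⌊(u i + r) / ρ⌋ + 1 - ⌊(u i - r) / ρ⌋ := by
            have : (((⌊(u i + r) / ρ⌋ + 1 - ⌊(u i - r) / ρ⌋).toNat : ℕ) : ℤ) =
              ⌊(u i + r) / ρ⌋ + 1 - ⌊(u i - r) / ρ⌋ := Int.toNat_of_nonneg (by omega)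
            exact_mod_cast this
          rw [h3]
          have h4 := Int.floor_le ((u i + r) / ρ)
          have h5 := Int.lt_floor_add_one ((u i - r) / ρ)
          have h6 : 2 * r / ρ = (u i + r) / ρ - (u i - r) / ρ := by ring
          rw [h6]
          linarith
      _ = _ := by simp

/-- A family of rational points with denominators comparable to `M ^ n` which is roughly
`ρ`-separated and whose `2ρ`-neighbourhood covers half of the unit cube,
where `ρ = 2 * 8 ^ n / M ^ (n + 1)`. -/
theorem exists_rational_net {n M : ℕ} (hM : 1 ≤ M) {ρ : ℝ}
    (hρ : ρ = 2 * 8 ^ n / (M : ℝ) ^ (n + 1)) :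
    ∃ P : Finset (Fin n → ℝ), (∀ v ∈ P, ‖v‖ ≤ 2 ∧ ∃ q : ℕ, M ^ n < 2 * 8 ^ n * q ∧ q ≤ M ^ n ∧
        ∃ p : Fin n → ℤ, ∀ i, q * v i = p i) ∧
      1 / 2 ≤ (P.card : ℝ) * (4 * ρ) ^ n ∧
      ∀ (S : Finset (Fin n → ℝ)) (u : Fin n → ℝ) (r : ℝ), 0 ≤ r → S ⊆ P →
        (∀ v ∈ S, dist v u ≤ r) → (S.card : ℝ) ≤ (2 * r / ρ + 2) ^ n := by
  classical
  have hM0 : (0 : ℝ) < M := by exact_mod_cast hM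
  have hM1 : (1 : ℝ) ≤ M := by exact_mod_cast hM
  have hρ0 : 0 < ρ := by rw [hρ]; positivity
  let num : ℕ → Finset (Fin n → ℤ) := fun q => Fintype.piFinset fun _ => Finset.Icc (-1) (q + 1)
  let pt : ℕ → (Fin n → ℤ) → Fin n → ℝ := fun q p i => p i / q
  let Q : Finset ℕ := (Finset.Icc 1 (M ^ n)).filter fun q => M ^ n < 2 * 8 ^ n * q
  let Q' : Finset ℕ := (Finset.Icc 1 (M ^ n)).filter fun q => ¬ M ^ n < 2 * 8 ^ n * q
  let R : Finset (Fin n → ℝ) := Q.biUnion fun q => (num q).image (pt q)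
  obtain ⟨P, hPR, hdense, hsep⟩ := exists_subset_dense_separated R hρ0
  refine ⟨P, fun v hv => ?_, ?_, hsep⟩
  · obtain ⟨q, hq, hv⟩ := Finset.mem_biUnion.1 (hPR hv)
    obtain ⟨p, hp, rfl⟩ := Finset.mem_image.1 hv
    simp only [Q, Finset.mem_filter, Finset.mem_Icc] at hq
    have hq1 : (1 : ℝ) ≤ q := by exact_mod_cast hq.1.1
    refine ⟨(pi_norm_le_iff_of_nonneg (by norm_num)).2 fun i => ?_, q, hq.2, hq.1.2, p, fun i => ?_⟩
    · have := Fintype.mem_piFinset.1 hp i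
      rw [Finset.mem_Icc] at this
      have h1 : (-1 : ℝ) ≤ p i := by exact_mod_cast this.1
      have h2 : (p i : ℝ) ≤ q + 1 := by exact_mod_cast this.2
      simp only [pt]
      rw [Real.norm_eq_abs, abs_le, le_div_iff₀ (by linarith), div_le_iff₀ (by linarith)]
      constructor <;> linarith
    · simp only [pt]; field_simp
  have hcover : Icc (0 : Fin n → ℝ) 1 ⊆ (⋃ v ∈ P, Metric.closedBall v (2 * ρ)) ∪
      ⋃ q ∈ Q', ⋃ p ∈ num q, Metric.closedBall (pt q p) (1 / (q * M)) := by
    intro x hx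
    obtain ⟨q, hq1, hq, p, hp⟩ := exists_simultaneous_approx hM x
    have hq1' : (1 : ℝ) ≤ q := by exact_mod_cast hq1
    have hpn : p ∈ num q := by
      rw [Fintype.mem_piFinset]
      intro i
      have h1 := (hp i).trans (div_le_one_of_le₀ hM1 hM0.le)
      rw [abs_le] at h1
      have h2 : (0 : ℝ) ≤ x i := hx.1 i
      have h3 : x i ≤ (1 : ℝ) := hx.2 i
      have h4 : (-1 : ℝ) ≤ p i := by nlinarith
      have h5 : (p i : ℝ) ≤ q + 1 := by nlinarith
      rw [Finset.mem_Icc]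
      exact ⟨by exact_mod_cast h4, by exact_mod_cast h5⟩
    have hd : dist x (pt q p) ≤ 1 / (q * M) := by
      refine (dist_pi_le_iff (by positivity)).2 fun i => ?_
      have : x i - pt q p i = (q * x i - p i) / q := by simp only [pt]; field_simp
      rw [Real.dist_eq, this, abs_div, abs_of_pos (by linarith : (0 : ℝ) < q),
        mul_comm (q : ℝ) (M : ℝ), ← div_div]
      gcongr
      exact hp i
    by_cases h : M ^ n < 2 * 8 ^ n * q
    · left
      have hR : pt q p ∈ R := Finset.mem_biUnion.2 ⟨q, by simp [Q, hq1, hq, h],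
        Finset.mem_image_of_mem _ hpn⟩
      obtain ⟨v, hv, hvd⟩ := hdense _ hR
      refine mem_iUnion₂.2 ⟨v, hv, ?_⟩
      have h' : (M : ℝ) ^ n ≤ 2 * 8 ^ n * q := by exact_mod_cast h.le
      have : 1 / (q * M) ≤ ρ := by
        rw [hρ, div_le_div_iff₀ (by positivity) (by positivity), pow_succ]
        nlinarith
      rw [Metric.mem_closedBall]
      linarith [dist_triangle x (pt q p) v]
    · right
      exact mem_iUnion₂.2 ⟨q, by simp [Q', hq1, hq, not_lt.1 h], mem_iUnion₂.2 ⟨p, hpn, hd⟩⟩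
  have hbad : ∀ q ∈ Q', volume (⋃ p ∈ num q, Metric.closedBall (pt q p) (1 / (q * M))) ≤
      ENNReal.ofReal (8 ^ n / M ^ n) := by
    intro q hq
    simp only [Q', Finset.mem_filter, Finset.mem_Icc] at hq
    have hq1 : (1 : ℝ) ≤ q := by exact_mod_cast hq.1.1
    refine (measure_biUnion_finset_le _ _).trans ?_
    rw [Finset.sum_congr rfl fun p _ => Real.volume_pi_closedBall _ (by positivity)]
    rw [Finset.sum_const, nsmul_eq_mul, ← ENNReal.ofReal_natCast,
      ← ENNReal.ofReal_mul (by positivity)]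
    apply ENNReal.ofReal_le_ofReal
    rw [Fintype.card_piFinset, Finset.prod_const, Finset.card_univ, Fintype.card_fin, Int.card_Icc]
    have : ((q : ℤ) + 1 + 1 - -1).toNat = q + 3 := by omega
    rw [this, ← div_pow]
    push_cast
    rw [← mul_pow]
    gcongr
    rw [mul_one_div, mul_div_assoc', div_le_div_iff₀ (by positivity) hM0]
    nlinarith
  have hQ' : (Q'.card : ℝ) * (8 ^ n / M ^ n) ≤ 1 / 2 := by
    have : Q'.card ≤ M ^ n / (2 * 8 ^ n) := by
      calc Q'.card ≤ (Finset.Icc 1 (M ^ n / (2 * 8 ^ n))).card := by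
            refine Finset.card_le_card fun q hq => ?_
            simp only [Q', Finset.mem_filter, Finset.mem_Icc] at hq
            rw [Finset.mem_Icc, Nat.le_div_iff_mul_le (by positivity)]
            exact ⟨hq.1.1, by linarith [hq.2]⟩
        _ = _ := by simp
    rw [Nat.le_div_iff_mul_le (by positivity)] at this
    have : (Q'.card : ℝ) * (2 * 8 ^ n) ≤ M ^ n := by exact_mod_cast this
    rw [mul_div_assoc', div_le_iff₀ (by positivity)]
    linarith
  have hvol := (measure_mono hcover).trans (measure_union_le (μ := volume) _ _)
  have h1 : volume (⋃ v ∈ P, Metric.closedBall v (2 * ρ)) ≤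
      ENNReal.ofReal (P.card * (4 * ρ) ^ n) := by
    refine (measure_biUnion_finset_le _ _).trans ?_
    rw [Finset.sum_congr rfl fun p _ => Real.volume_pi_closedBall _ (by positivity)]
    rw [Finset.sum_const, nsmul_eq_mul, ← ENNReal.ofReal_natCast,
      ← ENNReal.ofReal_mul (by positivity), Fintype.card_fin]
    apply ENNReal.ofReal_le_ofReal
    exact le_of_eq (by ring)
  have h2 : volume (⋃ q ∈ Q', ⋃ p ∈ num q, Metric.closedBall (pt q p) (1 / (q * M))) ≤
      ENNReal.ofReal (1 / 2) := by
    refine (measure_biUnion_finset_le _ _).trans ((Finset.sum_le_card_nsmul _ _ _ hbad).trans ?_)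
    rw [nsmul_eq_mul, ← ENNReal.ofReal_natCast, ← ENNReal.ofReal_mul (by positivity)]
    exact ENNReal.ofReal_le_ofReal hQ'
  have h3 := hvol.trans (add_le_add h1 h2)
  rw [Real.volume_Icc_pi, ← ENNReal.ofReal_add (by positivity) (by positivity)] at h3
  simp only [Pi.one_apply, Pi.zero_apply, sub_zero, ENNReal.ofReal_one, Finset.prod_const_one,
    ENNReal.one_le_ofReal] at h3
  linarith

theorem integral_sum_indicator {Ω ι : Type*} [MeasurableSpace Ω] (μ : Measure Ω)
    [IsFiniteMeasure μ] (P : Finset ι) {A : ι → Set Ω} (hA : ∀ i, MeasurableSet (A i)) :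
    ∫ x, ∑ i ∈ P, (A i).indicator (fun _ => (1 : ℝ)) x ∂μ = ∑ i ∈ P, μ.real (A i) := by
  rw [integral_finsetSum _ fun i _ => (integrable_const (1 : ℝ)).indicator (hA i)]
  exact Finset.sum_congr rfl fun i _ => by simp [integral_indicator_const _ (hA i)]

theorem integral_sum_indicator_mul {Ω ι κ : Type*} [MeasurableSpace Ω] (μ : Measure Ω)
    [IsFiniteMeasure μ] (P : Finset ι) (Q : Finset κ) {A : ι → Set Ω} {B : κ → Set Ω}
    (hA : ∀ i, MeasurableSet (A i)) (hB : ∀ i, MeasurableSet (B i)) :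
    ∫ x, (∑ i ∈ P, (A i).indicator (fun _ => (1 : ℝ)) x) *
      ∑ j ∈ Q, (B j).indicator (fun _ => (1 : ℝ)) x ∂μ =
      ∑ i ∈ P, ∑ j ∈ Q, μ.real (A i ∩ B j) := by
  classical
  rw [← Finset.sum_product', ← integral_sum_indicator μ (P ×ˢ Q) (A := fun k => A k.1 ∩ B k.2)
    fun k => (hA _).inter (hB _)]
  refine integral_congr_ae (Filter.Eventually.of_forall fun x => ?_)
  simp only [Finset.sum_mul_sum, Finset.sum_product]
  refine Finset.sum_congr rfl fun i _ => Finset.sum_congr rfl fun j _ => ?_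
  by_cases h1 : x ∈ A i <;> by_cases h2 : x ∈ B j <;> simp [h1, h2]

/-- Points of `ℝⁿ` admitting infinitely many simultaneous approximations of quality `φ`. -/
def simApprox (n : ℕ) (φ : ℕ → ℝ) : Set (Fin n → ℝ) :=
  {x | ∃ᶠ q : ℕ in Filter.atTop, ∃ p : Fin n → ℤ, ∀ i, |q * x i - p i| ≤ φ q}

theorem mul_overlap_pow_le {n s t : ℕ} (hn : 1 ≤ n) (hst : s ≤ t) {K ρs ρt rs rt A B : ℝ}
    (hK : 0 < K) (hρs : ρs = K / (2 ^ s) ^ (n + 1)) (hρt : ρt = K / (2 ^ t) ^ (n + 1))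
    (hrs : 0 < rs) (hrt : 0 < rt) (hA0 : 0 ≤ A) (hB : 1 / 2 ≤ B * (4 * ρt) ^ n)
    (hA : A ≤ (4 / ρs + 2) ^ n) :
    A * ((4 * rs / ρt + 2) ^ n * (2 * rt) ^ n) ≤
      2 * 16 ^ n * ((A * (2 * rs) ^ n) * (B * (2 * rt) ^ n)) +
      2 * 16 ^ n * (4 + 2 * K) ^ n * ((1 / 2) ^ (t - s) * (B * (2 * rt) ^ n)) := by
  have hρs0 : 0 < ρs := by rw [hρs]; positivity
  have hρt0 : 0 < ρt := by rw [hρt]; positivity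
  have hB' : (ρt ^ n)⁻¹ ≤ 2 * 4 ^ n * B := by
    rw [inv_le_iff_one_le_mul₀ (by positivity)]
    rw [mul_pow] at hB
    linarith
  have hB0 : 0 < B := by
    have : 0 < (ρt ^ n)⁻¹ := by positivity
    by_contra! h
    nlinarith [pow_pos (four_pos (α := ℝ)) n]
  have h1 : (4 * rs / ρt + 2) ^ n ≤ 2 * 16 ^ n * (2 * rs) ^ n * B + 4 ^ n := by
    calc (4 * rs / ρt + 2) ^ n ≤ 2 ^ (n - 1) * ((4 * rs / ρt) ^ n + 2 ^ n) :=
          add_pow_le (by positivity) (by norm_num) n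
      _ ≤ 2 ^ n * ((4 * rs / ρt) ^ n + 2 ^ n) := by gcongr <;> norm_num
      _ = 4 ^ n * (2 * rs) ^ n * (ρt ^ n)⁻¹ + 4 ^ n := by
          rw [show (4 : ℝ) * rs / ρt = 2 * (2 * rs) * ρt⁻¹ by ring, mul_pow, mul_pow, inv_pow,
            show (4 : ℝ) = 2 * 2 by norm_num, mul_pow 2 2]
          ring
      _ ≤ 4 ^ n * (2 * rs) ^ n * (2 * 4 ^ n * B) + 4 ^ n := by gcongr
      _ = _ := by
          rw [show (16 : ℝ) = 4 * 4 by norm_num, mul_pow 4 4]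
          ring
  have h2 : (ρs ^ n)⁻¹ ≤ (1 / 2) ^ (t - s) * (ρt ^ n)⁻¹ := by
    have e : ρs = 2 ^ ((t - s) * (n + 1)) * ρt := by
      have : (2 : ℝ) ^ t = 2 ^ (t - s) * 2 ^ s := by rw [← pow_add]; congr 1; omega
      rw [hρs, hρt, this, pow_mul]
      field_simp
      rw [mul_pow]
    rw [e, mul_pow, mul_inv, ← pow_mul, one_div, inv_pow]
    gcongr
    · norm_num
    · nlinarith [Nat.zero_le (t - s), Nat.mul_le_mul_left (t - s) hn, Nat.mul_le_mul_left
        ((t - s) * n) hn]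
  have h3 : A ≤ (4 + 2 * K) ^ n * ((1 / 2) ^ (t - s) * (2 * 4 ^ n * B)) := by
    calc A ≤ (4 / ρs + 2) ^ n := hA
      _ ≤ ((4 + 2 * K) * ρs⁻¹) ^ n := by
          gcongr
          have : ρs ≤ K := by
            rw [hρs]
            exact div_le_self hK.le (one_le_pow₀ (one_le_pow₀ (by norm_num)))
          have h4 : 1 ≤ K * ρs⁻¹ := by
            rw [← div_eq_mul_inv, one_le_div hρs0]; exact this
          rw [div_eq_mul_inv]
          linarith
      _ = (4 + 2 * K) ^ n * (ρs ^ n)⁻¹ := by rw [mul_pow, inv_pow]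
      _ ≤ (4 + 2 * K) ^ n * ((1 / 2) ^ (t - s) * (ρt ^ n)⁻¹) := by gcongr
      _ ≤ _ := by gcongr
  calc A * ((4 * rs / ρt + 2) ^ n * (2 * rt) ^ n)
      ≤ A * ((2 * 16 ^ n * (2 * rs) ^ n * B + 4 ^ n) * (2 * rt) ^ n) := by gcongr
    _ = 2 * 16 ^ n * ((A * (2 * rs) ^ n) * (B * (2 * rt) ^ n)) + 4 ^ n * (2 * rt) ^ n * A := by ring
    _ ≤ 2 * 16 ^ n * ((A * (2 * rs) ^ n) * (B * (2 * rt) ^ n)) + 4 ^ n * (2 * rt) ^ n *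
        ((4 + 2 * K) ^ n * ((1 / 2) ^ (t - s) * (2 * 4 ^ n * B))) := by gcongr
    _ = _ := by
      rw [show (16 : ℝ) = 4 * 4 by norm_num, mul_pow 4 4]
      ring

theorem le_volume_simApprox_inter {n : ℕ} (hn : 1 ≤ n) {φ : ℕ → ℝ} (hφ : ∀ k, 0 < φ k)
    (hmono : Antitone φ) (hφ1 : ∀ k, φ k ≤ 1)
    (hdiv : ¬ Summable fun t : ℕ => ((2 ^ n : ℕ) : ℝ) ^ t * φ ((2 ^ n) ^ t) ^ n) :
    ENNReal.ofReal (2 * 16 ^ n)⁻¹ ≤ volume (simApprox n φ ∩ Metric.closedBall 0 3) := by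
  classical
  set K : ℝ := 2 * 8 ^ n with hK
  have hK0 : 0 < K := by positivity
  set ρ : ℕ → ℝ := fun t => K / (2 ^ t) ^ (n + 1) with hρ
  have hρ0 : ∀ t, 0 < ρ t := fun t => by positivity
  set r : ℕ → ℝ := fun t => φ ((2 ^ n) ^ t) / (2 ^ n) ^ t with hr
  have hr0 : ∀ t, 0 < r t := fun t => div_pos (hφ _) (by positivity)
  have hr1 : ∀ t, r t ≤ 1 := fun t =>
    (div_le_self (hφ _).le (one_le_pow₀ (one_le_pow₀ (by norm_num)))).trans (hφ1 _)
  have hranti : ∀ s t, s ≤ t → r t ≤ r s := fun s t hst =>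
    div_le_div₀ (hφ _).le (hmono (Nat.pow_le_pow_right (by positivity) hst)) (by positivity)
      (pow_le_pow_right₀ (one_le_pow₀ (by norm_num)) hst)
  choose P hP hPcard hPsep using fun t : ℕ =>
    exists_rational_net (n := n) (M := 2 ^ t) Nat.one_le_two_pow (ρ := ρ t) (by simp [hρ, hK])
  set μ : Measure (Fin n → ℝ) := volume.restrict (Metric.closedBall 0 3)
  have hμfin : IsFiniteMeasure μ := isFiniteMeasure_restrict.2 measure_closedBall_lt_top.ne
  let f : ℕ → (Fin n → ℝ) → ℝ := fun t x =>
    ∑ v ∈ P t, (Metric.closedBall v (r t)).indicator (fun _ => (1 : ℝ)) x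
  have hball : ∀ v : Fin n → ℝ, ∀ t, μ.real (Metric.closedBall v (r t)) ≤ (2 * r t) ^ n := by
    intro v t
    refine ENNReal.toReal_le_of_le_ofReal (by have := hr0 t; positivity) ?_
    refine (Measure.restrict_apply_le _ _).trans ?_
    rw [Real.volume_pi_closedBall _ (hr0 t).le, Fintype.card_fin]
  have hball' : ∀ t, ∀ v ∈ P t, μ.real (Metric.closedBall v (r t)) = (2 * r t) ^ n := by
    intro t v hv
    rw [measureReal_restrict_apply Metric.isClosed_closedBall.measurableSet,
      inter_eq_self_of_subset_left, Measure.real, Real.volume_pi_closedBall _ (hr0 t).le,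
      Fintype.card_fin, ENNReal.toReal_ofReal (by have := hr0 t; positivity)]
    apply Metric.closedBall_subset_closedBall'
    rw [dist_zero_right]
    linarith [(hP t v hv).1, hr1 t]
  have hint : ∀ t, ∫ x, f t x ∂μ = (P t).card * (2 * r t) ^ n := by
    intro t
    rw [integral_sum_indicator μ (P t) (fun v => Metric.isClosed_closedBall.measurableSet),
      Finset.sum_congr rfl (hball' t), Finset.sum_const, nsmul_eq_mul]
  have hpair : ∀ s t, s ≤ t → ∫ x, f s x * f t x ∂μ ≤
      (P s).card * ((4 * r s / ρ t + 2) ^ n * (2 * r t) ^ n) := by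
    intro s t hst
    rw [integral_sum_indicator_mul μ (P s) (P t)
      (fun v => Metric.isClosed_closedBall.measurableSet)
      (fun v => Metric.isClosed_closedBall.measurableSet)]
    rw [← nsmul_eq_mul]
    refine Finset.sum_le_card_nsmul _ _ _ fun v _ => ?_
    have hsub : ∀ w ∈ P t, w ∉ (P t).filter (fun w => dist w v ≤ 2 * r s) →
        μ.real (Metric.closedBall v (r s) ∩ Metric.closedBall w (r t)) = 0 := by
      intro w hw hwv
      have hd : 2 * r s < dist w v := by
        by_contra! h
        exact hwv (Finset.mem_filter.2 ⟨hw, h⟩)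
      have : Disjoint (Metric.closedBall v (r s)) (Metric.closedBall w (r t)) := by
        apply Metric.closedBall_disjoint_closedBall
        rw [dist_comm]
        linarith [hranti s t hst]
      rw [this.inter_eq, measureReal_empty]
    rw [← Finset.sum_subset (Finset.filter_subset (fun w => dist w v ≤ 2 * r s) _) hsub]
    refine (Finset.sum_le_card_nsmul _ _ ((2 * r t) ^ n) fun w _ =>
      (measureReal_mono inter_subset_right).trans (hball w t)).trans ?_
    rw [nsmul_eq_mul]
    refine mul_le_mul_of_nonneg_right ?_ (by have := hr0 t; positivity)
    refine (hPsep t _ v (2 * r s) (by have := hr0 s; positivity) (Finset.filter_subset _ _)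
      fun w hw => (Finset.mem_filter.1 hw).2).trans_eq ?_
    ring
  have hKS := inv_le_measureReal_frequently_pos μ (f := f)
    (fun t x => Finset.sum_nonneg fun v _ => indicator_nonneg (fun _ _ => zero_le_one) x)
    (fun t => Finset.measurable_fun_sum _ fun v _ =>
      measurable_const.indicator Metric.isClosed_closedBall.measurableSet)
    (fun t => ⟨(P t).card, fun x => by
      refine (Finset.sum_le_card_nsmul _ _ 1 fun v _ => ?_).trans_eq (by simp)
      exact indicator_le_self' (fun _ _ => zero_le_one) x⟩)
    (C := 2 * 16 ^ n) (D := 2 * 16 ^ n * (4 + 2 * K) ^ n) (by positivity) (by positivity)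
    (fun s t hst => by
      refine (hpair s t hst).trans ?_
      rw [hint, hint]
      refine mul_overlap_pow_le hn hst hK0 rfl rfl (hr0 s) (hr0 t) (by positivity)
        (hPcard t) ?_
      refine (hPsep s _ 0 2 (by norm_num) subset_rfl fun v hv => ?_).trans_eq
        (by norm_num [hρ])
      rw [dist_zero_right]
      exact (hP s v hv).1)
    (by
      intro hsum
      apply hdiv
      refine Summable.of_nonneg_of_le (fun t => ?_) (fun t => ?_)
        (hsum.mul_left (2 * (2 * K) ^ n))
      · exact mul_nonneg (by positivity) (pow_nonneg (hφ _).le _)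
      · rw [hint]
        have h1 := hPcard t
        have h2 : 2 * r t = (4 * ρ t) * (2 ^ t * φ ((2 ^ n) ^ t) / (2 * K)) := by
          simp only [hr, hρ]
          rw [← pow_mul, mul_comm n t, pow_mul]
          field_simp
          ring
        rw [h2, mul_pow _ (_ / _), div_pow, mul_pow (2 ^ t)]
        have h3 : 0 ≤ (2 ^ t) ^ n * φ ((2 ^ n) ^ t) ^ n :=
          mul_nonneg (by positivity) (pow_nonneg (hφ _).le _)
        have h4 : ((2 ^ n : ℕ) : ℝ) ^ t = (2 ^ t) ^ n := by push_cast; rw [pow_right_comm]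
        rw [h4]
        have h5 : 2 * (2 * K) ^ n * ((P t).card * ((4 * ρ t) ^ n *
            ((2 ^ t) ^ n * φ ((2 ^ n) ^ t) ^ n / (2 * K) ^ n))) =
            2 * ((P t).card * (4 * ρ t) ^ n) * ((2 ^ t) ^ n * φ ((2 ^ n) ^ t) ^ n) := by
          field_simp
        rw [h5]
        nlinarith)
  have hmeas : μ {x | ∃ᶠ t in Filter.atTop, 0 < f t x} ≤
      volume (simApprox n φ ∩ Metric.closedBall 0 3) := by
    rw [Measure.restrict_apply' Metric.isClosed_closedBall.measurableSet]
    refine measure_mono (inter_subset_inter_left _ fun x hx => ?_)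
    refine Filter.frequently_atTop.2 fun q₀ => ?_
    obtain ⟨t, ht, hx⟩ := Filter.frequently_atTop.1 hx (2 * 8 ^ n * q₀)
    obtain ⟨v, hv, hxv⟩ := Finset.exists_ne_zero_of_sum_ne_zero hx.ne'
    have hxv : x ∈ Metric.closedBall v (r t) := mem_of_indicator_ne_zero hxv
    obtain ⟨-, q, hq, hqN, p, hp⟩ := hP t v hv
    have hpow : (2 ^ t) ^ n = (2 ^ n) ^ t := pow_right_comm 2 t n
    refine ⟨q, ?_, p, fun i => ?_⟩
    · have h1 : t < (2 ^ n) ^ t := Nat.lt_pow_self (Nat.one_lt_two_pow (by omega))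
      rw [hpow] at hq
      have h2 : 2 * 8 ^ n * q₀ < 2 * 8 ^ n * q := lt_of_le_of_lt ht (h1.trans hq)
      exact (lt_of_mul_lt_mul_left h2 (by positivity)).le
    · have h1 : |x i - v i| ≤ r t := by
        have := (dist_pi_le_iff (hr0 t).le).1 hxv i
        rwa [Real.dist_eq] at this
      rw [← hp i, ← mul_sub, abs_mul, Nat.abs_cast]
      rw [hpow] at hqN
      have h2 : (q : ℝ) ≤ (2 ^ n) ^ t := by exact_mod_cast hqN
      calc (q : ℝ) * |x i - v i| ≤ (2 ^ n) ^ t * r t := by gcongr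
        _ = φ ((2 ^ n) ^ t) := by simp only [hr]; field_simp
        _ ≤ φ q := hmono hqN
  refine le_trans ?_ hmeas
  rw [ENNReal.ofReal_le_iff_le_toReal (measure_ne_top _ _)]
  exact hKS

theorem measurableSet_simApprox (n : ℕ) (φ : ℕ → ℝ) : MeasurableSet (simApprox n φ) := by
  have : simApprox n φ = ⋂ N : ℕ, ⋃ q ≥ N, ⋃ p : Fin n → ℤ,
      {x | ∀ i, |(q : ℝ) * x i - p i| ≤ φ q} := by
    ext x
    simp [simApprox, Filter.frequently_atTop]
  rw [this]
  refine MeasurableSet.iInter fun N => MeasurableSet.iUnion fun q => MeasurableSet.iUnion fun _ =>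
    MeasurableSet.iUnion fun p => ?_
  simp only [ofPred_forall]
  exact MeasurableSet.iInter fun i => measurableSet_le (by fun_prop) measurable_const

theorem preimage_simApprox_subset {n L : ℕ} (hL : 0 < L) (φ : ℕ → ℝ) (x₀ : Fin n → ℝ) :
    (fun x : Fin n → ℝ => (L : ℝ) • x) ⁻¹' ((fun y => y + fun i => -(⌊L * x₀ i⌋ : ℝ)) ⁻¹'
      (simApprox n (fun k => φ (L * k)) ∩ Metric.closedBall 0 3)) ⊆
      simApprox n φ ∩ Metric.closedBall x₀ (4 / L) := by
  rintro x ⟨hx, hx3⟩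
  have hL0 : (0 : ℝ) < L := by exact_mod_cast hL
  constructor
  · refine Filter.frequently_atTop.2 fun N => ?_
    obtain ⟨q, hq, p, hp⟩ := Filter.frequently_atTop.1 hx N
    refine ⟨L * q, le_trans hq (Nat.le_mul_of_pos_left q hL),
      fun i => p i + q * ⌊L * x₀ i⌋, fun i => ?_⟩
    convert! hp i using 2
    simp only [Pi.add_apply, Pi.smul_apply, smul_eq_mul]
    push_cast
    ring
  · refine (dist_pi_le_iff (by positivity)).2 fun i => ?_
    have h1 := (dist_pi_le_iff (by norm_num)).1 hx3 i
    simp only [Pi.add_apply, Pi.smul_apply, smul_eq_mul, Pi.zero_apply, dist_zero_right,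
      Real.norm_eq_abs] at h1
    rw [Real.dist_eq, le_div_iff₀ hL0]
    have habs : |x i - x₀ i| * L = |(x i - x₀ i) * L| := by rw [abs_mul, abs_of_pos hL0]
    rw [habs]
    rw [abs_le] at h1 ⊢
    have h2 := Int.floor_le (L * x₀ i)
    have h3 := Int.lt_floor_add_one (L * x₀ i)
    constructor <;> linarith

/-- The case of simultaneous approximation, obtained from the local lower bound by scaling and the
Lebesgue density theorem. -/
theorem ae_mem_simApprox {n : ℕ} (hn : 1 ≤ n) {φ : ℕ → ℝ} (hφ : ∀ k, 0 < φ k)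
    (hmono : Antitone φ) (hφ1 : ∀ k, φ k ≤ 1)
    (hdiv : ¬ Summable fun t : ℕ => ((2 ^ n : ℕ) : ℝ) ^ t * φ ((2 ^ n) ^ t) ^ n) :
    ∀ᵐ x, x ∈ simApprox n φ := by
  set c : ℝ := (2 * 16 ^ n)⁻¹
  have hc : 0 < c := by positivity
  filter_upwards [Besicovitch.ae_tendsto_measure_inter_div_of_measurableSet volume
    (measurableSet_simApprox n φ)] with x₀ hx₀
  by_contra hx
  rw [indicator_of_notMem hx] at hx₀
  have hrad : Filter.Tendsto (fun l : ℕ => 4 / ((((2 ^ n) ^ l : ℕ)) : ℝ)) Filter.atTop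
      (nhdsWithin 0 (Ioi 0)) := by
    refine tendsto_nhdsWithin_iff.2 ⟨?_, Filter.Eventually.of_forall fun l => ?_⟩
    · refine Filter.Tendsto.const_div_atTop ?_ _
      push_cast
      exact tendsto_pow_atTop_atTop_of_one_lt (one_lt_pow₀ (by norm_num) (by omega))
    · rw [mem_Ioi]; positivity
  have hlim := hx₀.comp hrad
  have hbd : ∀ l : ℕ, ENNReal.ofReal (c / 8 ^ n) ≤
      volume (simApprox n φ ∩ Metric.closedBall x₀ (4 / (((2 ^ n) ^ l : ℕ) : ℝ))) /
        volume (Metric.closedBall x₀ (4 / (((2 ^ n) ^ l : ℕ) : ℝ))) := by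
    intro l
    set L : ℕ := (2 ^ n) ^ l with hL
    have hLpos : 0 < L := by positivity
    have hL0 : (0 : ℝ) < L := by exact_mod_cast hLpos
    have h1 := le_volume_simApprox_inter hn (φ := fun k => φ (L * k)) (fun k => hφ _)
      (fun i j hij => hmono (Nat.mul_le_mul_left L hij)) (fun k => hφ1 _) (by
        intro hs
        apply hdiv
        rw [← summable_nat_add_iff l]
        refine (hs.mul_left (L : ℝ)).congr fun t => ?_
        rw [pow_add, pow_add, hL, mul_comm ((2 ^ n) ^ t) ((2 ^ n) ^ l)]
        push_cast
        ring)
    have h2 := measure_mono (μ := volume) (preimage_simApprox_subset hLpos φ x₀)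
    rw [Measure.addHaar_preimage_smul _ hL0.ne', measure_preimage_add_right] at h2
    rw [Real.volume_pi_closedBall _ (by positivity), Fintype.card_fin]
    rw [ENNReal.le_div_iff_mul_le
      (Or.inl (ENNReal.ofReal_pos.2 (by positivity)).ne') (Or.inl ENNReal.ofReal_ne_top)]
    refine le_trans (le_trans (le_of_eq ?_) (mul_le_mul_right h1 _)) h2
    rw [← ENNReal.ofReal_mul (by positivity), ← ENNReal.ofReal_mul (by positivity),
      Module.finrank_fin_fun, abs_of_pos (by positivity)]
    congr 1
    rw [show 2 * (4 / (L : ℝ)) = 8 / L by ring, div_pow]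
    simp only [c]
    field_simp
  have := ge_of_tendsto' hlim hbd
  rw [nonpos_iff_eq_zero, ENNReal.ofReal_eq_zero] at this
  exact absurd this (not_le.2 (by positivity))

/-- The linear form `Y ↦ ∑ i, q i • Y i` on `m × n` matrices over the circle. -/
def circleForm {m : ℕ} (n : ℕ) (q : Fin m → ℕ) :
    (Fin m → Fin n → UnitAddCircle) →+ (Fin n → UnitAddCircle) :=
  ∑ i, q i • Pi.evalAddMonoidHom (fun _ => Fin n → UnitAddCircle) i

theorem circleForm_apply {m n : ℕ} (q : Fin m → ℕ) (Y : Fin m → Fin n → UnitAddCircle) :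
    circleForm n q Y = ∑ i, q i • Y i := by
  simp [circleForm, AddMonoidHom.finsetSum_apply]

theorem continuous_circleForm {m : ℕ} (n : ℕ) (q : Fin m → ℕ) : Continuous (circleForm n q) := by
  have : ⇑(circleForm n q) = fun Y => ∑ i, q i • Y i := funext fun Y => circleForm_apply q Y
  rw [this]
  fun_prop

theorem circleForm_coe {m n : ℕ} (q : Fin m → ℕ) (X : Fin m → Fin n → ℝ) (j : Fin n) :
    circleForm n q (fun i j => (X i j : UnitAddCircle)) j =
      ((∑ i, (q i : ℝ) * X i j : ℝ) : UnitAddCircle) := by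
  rw [circleForm_apply, Finset.sum_apply]
  have := map_sum (QuotientAddGroup.mk' (AddSubgroup.zmultiples (1 : ℝ)))
    (fun i => (q i : ℝ) * X i j) Finset.univ
  refine Eq.trans (Finset.sum_congr rfl fun i _ => ?_) this.symm
  rw [← nsmul_eq_mul]
  rfl

theorem circleForm_prod_surjective {m n : ℕ} {q r : Fin m → ℕ} {i k : Fin m}
    (h : q i * r k ≠ q k * r i) :
    Function.Surjective ((circleForm n q).prod (circleForm n r)) := by
  have hik : i ≠ k := by rintro rfl; exact h rfl
  have hΔ : (q i : ℝ) * r k - q k * r i ≠ 0 := by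
    rw [sub_ne_zero]; exact_mod_cast h
  have hmk : ∀ u : Fin n → UnitAddCircle, ∃ U : Fin n → ℝ, ∀ j, (U j : UnitAddCircle) = u j :=
    fun u => ⟨fun j => (u j).out, fun j => QuotientAddGroup.out_eq' _⟩
  rintro ⟨u, v⟩
  obtain ⟨U, hU⟩ := hmk u
  obtain ⟨V, hV⟩ := hmk v
  let X : Fin m → Fin n → ℝ := fun l j =>
    if l = i then (r k * U j - q k * V j) / (q i * r k - q k * r i)
    else if l = k then (q i * V j - r i * U j) / (q i * r k - q k * r i) else 0
  have hX : ∀ (p : Fin m → ℕ) j, ∑ l, (p l : ℝ) * X l j = p i * X i j + p k * X k j := by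
    intro p j
    refine Finset.sum_eq_add i k hik ?_ (by simp) (by simp)
    intro l _ hl
    simp [X, hl.1, hl.2]
  refine ⟨fun i j => (X i j : UnitAddCircle), Prod.ext (funext fun j => ?_) (funext fun j => ?_)⟩
  · change circleForm n q _ j = u j
    rw [circleForm_coe, hX, ← hU]
    congr 1
    simp only [X, if_true, if_neg hik.symm]
    rw [← mul_div_assoc, ← mul_div_assoc, ← add_div, div_eq_iff hΔ]
    ring
  · change circleForm n r _ j = v j
    rw [circleForm_coe, hX, ← hV]
    congr 1
    simp only [X, if_true, if_neg hik.symm]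
    rw [← mul_div_assoc, ← mul_div_assoc, ← add_div, div_eq_iff hΔ]
    ring

theorem circleForm_surjective {m n : ℕ} {q : Fin m → ℕ} {i : Fin m} (h : q i ≠ 0) :
    Function.Surjective (circleForm n q) := by
  have h0 : (q i : ℝ) ≠ 0 := by exact_mod_cast h
  intro u
  refine ⟨fun l j => ((if l = i then (u j).out / q i else 0 : ℝ) : UnitAddCircle),
    funext fun j => ?_⟩
  rw [circleForm_coe q (fun l j => if l = i then (u j).out / q i else 0)]
  simp only [mul_ite, mul_zero, Finset.sum_ite_eq', Finset.mem_univ, if_true]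
  rw [mul_div_cancel₀ _ h0]
  exact QuotientAddGroup.out_eq' _

instance isProbabilityMeasure_volume_unitAddCircle :
    IsProbabilityMeasure (volume : Measure UnitAddCircle) :=
  ⟨UnitAddCircle.measure_univ⟩

instance isProbabilityMeasure_volume_pi_unitAddCircle (n : ℕ) :
    IsProbabilityMeasure (volume : Measure (Fin n → UnitAddCircle)) :=
  Measure.pi.instIsProbabilityMeasure fun _ => (volume : Measure UnitAddCircle)

instance isProbabilityMeasure_volume_pi_pi_unitAddCircle (m n : ℕ) :
    IsProbabilityMeasure (volume : Measure (Fin m → Fin n → UnitAddCircle)) :=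
  Measure.pi.instIsProbabilityMeasure fun _ => (volume : Measure (Fin n → UnitAddCircle))

instance isAddHaarMeasure_volume_pi_unitAddCircle (n : ℕ) :
    (volume : Measure (Fin n → UnitAddCircle)).IsAddHaarMeasure :=
  Measure.pi.isAddHaarMeasure fun _ => (volume : Measure UnitAddCircle)

instance isAddHaarMeasure_volume_pi_pi_unitAddCircle (m n : ℕ) :
    (volume : Measure (Fin m → Fin n → UnitAddCircle)).IsAddHaarMeasure :=
  Measure.pi.isAddHaarMeasure fun _ => (volume : Measure (Fin n → UnitAddCircle))

instance isAddHaarMeasure_volume_prod_pi_unitAddCircle (n : ℕ) :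
    ((volume : Measure (Fin n → UnitAddCircle)).prod
      (volume : Measure (Fin n → UnitAddCircle))).IsAddHaarMeasure :=
  Measure.prod.instIsAddHaarMeasure volume volume

/-- Linear forms with non-proportional coefficient vectors are independent. -/
theorem volume_preimage_circleForm_inter {m n : ℕ} {q r : Fin m → ℕ} {i k : Fin m}
    (h : q i * r k ≠ q k * r i) {S S' : Set (Fin n → UnitAddCircle)} (hS : MeasurableSet S)
    (hS' : MeasurableSet S') :
    volume (circleForm n q ⁻¹' S ∩ circleForm n r ⁻¹' S') = volume S * volume S' := by
  have hmp := AddMonoidHom.measurePreserving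
    (μ := (volume : Measure (Fin m → Fin n → UnitAddCircle)))
    (ν := (volume : Measure (Fin n → UnitAddCircle)).prod volume)
    (f := (circleForm n q).prod (circleForm n r))
    ((continuous_circleForm n q).prodMk (continuous_circleForm n r))
    (circleForm_prod_surjective h) (by rw [measure_univ, measure_univ])
  rw [← Measure.prod_prod, ← hmp.measure_preimage (hS.prod hS').nullMeasurableSet]
  rfl

theorem volume_preimage_circleForm {m n : ℕ} {q : Fin m → ℕ} {i : Fin m} (h : q i ≠ 0)
    {S : Set (Fin n → UnitAddCircle)} (hS : MeasurableSet S) :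
    volume (circleForm n q ⁻¹' S) = volume S :=
  (AddMonoidHom.measurePreserving (μ := (volume : Measure (Fin m → Fin n → UnitAddCircle)))
    (ν := (volume : Measure (Fin n → UnitAddCircle))) (f := circleForm n q)
    (continuous_circleForm n q) (circleForm_surjective h)
    (by rw [measure_univ, measure_univ])).measure_preimage hS.nullMeasurableSet

theorem volume_closedBall_pi_unitAddCircle {n : ℕ} {δ : ℝ} (h0 : 0 ≤ δ) (h1 : δ ≤ 1 / 2) :
    volume.real (Metric.closedBall (0 : Fin n → UnitAddCircle) δ) = (2 * δ) ^ n := by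
  rw [Measure.real, MeasureTheory.volume_pi_closedBall _ h0]
  simp only [AddCircle.volume_closedBall, Finset.prod_const, Finset.card_univ, Fintype.card_fin]
  rw [min_eq_right (by linarith), ENNReal.toReal_pow, ENNReal.toReal_ofReal (by linarith)]

theorem sum_Ioc_inv_sq_le (N : ℕ) : ∑ k ∈ Finset.Ioc 1 N, (1 / (k : ℝ)) ^ 2 ≤ (3 / 4 : ℝ) := by
  rcases Nat.lt_or_ge N 2 with hN | hN
  · rw [Finset.Ioc_eq_empty (by omega)]
    norm_num
  suffices h : ∑ k ∈ Finset.Ioc 1 N, (1 / (k : ℝ)) ^ 2 ≤ 3 / 4 - 1 / (N : ℝ) by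
    have : (0 : ℝ) ≤ 1 / N := by positivity
    linarith
  induction N, hN using Nat.le_induction with
  | base => norm_num [Finset.sum_Ioc_succ_top]
  | succ N hN ih =>
    rw [Finset.sum_Ioc_succ_top (by omega)]
    have h0 : (0 : ℝ) < N := by exact_mod_cast (by omega : 0 < N)
    have : (1 / ((N + 1 : ℕ) : ℝ)) ^ 2 ≤ 1 / N - 1 / ((N + 1 : ℕ) : ℝ) := by
      push_cast
      rw [div_sub_div _ _ h0.ne' (by positivity), div_pow, div_le_div_iff₀ (by positivity)
        (by positivity)]
      nlinarith
    linarith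

/-- The vectors in `[1, 4 ^ (t + 1)] ^ (d + 2)` outside `[1, 4 ^ t] ^ (d + 2)` whose first two
entries are coprime. -/
def coprimeBlock (d t : ℕ) : Finset (Fin (d + 2) → ℕ) :=
  (Fintype.piFinset fun _ => Finset.Ioc 0 (4 ^ (t + 1))).filter
    fun q => Nat.Coprime (q 0) (q 1) ∧ ∃ i, 4 ^ t < q i

theorem mem_coprimeBlock {d t : ℕ} {q : Fin (d + 2) → ℕ} :
    q ∈ coprimeBlock d t ↔
      (∀ i, 0 < q i ∧ q i ≤ 4 ^ (t + 1)) ∧ Nat.Coprime (q 0) (q 1) ∧ ∃ i, 4 ^ t < q i := by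
  simp [coprimeBlock]

theorem card_piFinset_dvd (d N k : ℕ) :
    (Fintype.piFinset fun i : Fin (d + 2) =>
      (Finset.Ioc 0 N).filter fun a => i = 0 ∨ i = 1 → k ∣ a).card = (N / k) ^ 2 * N ^ d := by
  rw [Fintype.card_piFinset, Fin.prod_univ_succ, Fin.prod_univ_succ]
  have h (i : Fin d) : ¬ (i.succ.succ = 0 ∨ i.succ.succ = 1) := by
    rintro (h | h)
    · exact Fin.succ_ne_zero _ h
    · exact Fin.succ_ne_zero _ (Fin.succ_injective _ h)
  simp only [h, false_imp_iff, Finset.filter_true, Nat.card_Ioc, Finset.prod_const,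
    Finset.card_univ, Fintype.card_fin, true_or, true_imp_iff, Nat.Ioc_filter_dvd_card_eq_div,
    Fin.succ_zero_eq_one, or_true, tsub_zero]
  ring

theorem le_card_coprimeBlock (d t : ℕ) :
    3 / 16 * ((4 : ℝ) ^ (t + 1)) ^ (d + 2) ≤ (coprimeBlock d t).card := by
  set N : ℕ := 4 ^ (t + 1) with hN
  have hNr : ((4 : ℝ) ^ (t + 1)) = N := by simp [hN]
  have hsub : (Fintype.piFinset fun _ : Fin (d + 2) => Finset.Ioc 0 N) ⊆
      coprimeBlock d t ∪ ((Fintype.piFinset fun _ : Fin (d + 2) => Finset.Ioc 0 (4 ^ t)) ∪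
        (Finset.Ioc 1 N).biUnion fun k => Fintype.piFinset fun i : Fin (d + 2) =>
          (Finset.Ioc 0 N).filter fun a => i = 0 ∨ i = 1 → k ∣ a) := by
    intro q hq
    simp only [Fintype.mem_piFinset, Finset.mem_Ioc] at hq
    simp only [Finset.mem_union, mem_coprimeBlock, Fintype.mem_piFinset, Finset.mem_biUnion,
      Finset.mem_filter, Finset.mem_Ioc]
    by_cases hc : Nat.Coprime (q 0) (q 1)
    · by_cases hi : ∃ i, 4 ^ t < q i
      · exact Or.inl ⟨hq, hc, hi⟩
      · push Not at hi
        exact Or.inr (Or.inl fun i => ⟨(hq i).1, hi i⟩)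
    · have hpos : 0 < Nat.gcd (q 0) (q 1) := Nat.gcd_pos_of_pos_left _ (hq 0).1
      have hne : Nat.gcd (q 0) (q 1) ≠ 1 := hc
      refine Or.inr (Or.inr ⟨Nat.gcd (q 0) (q 1), ⟨by omega,
        (Nat.le_of_dvd (hq 0).1 (Nat.gcd_dvd_left _ _)).trans (hq 0).2⟩, fun i => ⟨hq i, ?_⟩⟩)
      rintro (rfl | rfl)
      · exact Nat.gcd_dvd_left _ _
      · exact Nat.gcd_dvd_right _ _
  have hcard := (Finset.card_le_card hsub).trans ((Finset.card_union_le _ _).trans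
    (Nat.add_le_add_left ((Finset.card_union_le _ _).trans
      (Nat.add_le_add_left Finset.card_biUnion_le _)) _))
  simp only [card_piFinset_dvd] at hcard
  simp only [Fintype.card_piFinset, Nat.card_Ioc, tsub_zero, Finset.prod_const,
    Finset.card_univ, Fintype.card_fin] at hcard
  have hcard' : (N : ℝ) ^ (d + 2) ≤ (coprimeBlock d t).card + (((4 : ℝ) ^ t) ^ (d + 2) +
      ∑ k ∈ Finset.Ioc 1 N, ((N / k : ℕ) : ℝ) ^ 2 * (N : ℝ) ^ d) := by exact_mod_cast hcard
  have h1 : ((4 : ℝ) ^ t) ^ (d + 2) ≤ (N : ℝ) ^ (d + 2) / 16 := by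
    rw [← hNr, pow_succ (4 : ℝ) t, mul_pow, le_div_iff₀ (by norm_num)]
    gcongr
    calc (16 : ℝ) = 4 ^ 2 := by norm_num
      _ ≤ 4 ^ (d + 2) := pow_le_pow_right₀ (by norm_num) (by omega)
  have h2 : ∑ k ∈ Finset.Ioc 1 N, ((N / k : ℕ) : ℝ) ^ 2 * (N : ℝ) ^ d ≤
      3 / 4 * (N : ℝ) ^ (d + 2) := by
    calc _ ≤ ∑ k ∈ Finset.Ioc 1 N, (1 / (k : ℝ)) ^ 2 * (N : ℝ) ^ (d + 2) := by
          refine Finset.sum_le_sum fun k _ => ?_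
          calc _ ≤ ((N : ℝ) / k) ^ 2 * (N : ℝ) ^ d := by
                gcongr
                exact Nat.cast_div_le
            _ = _ := by ring
      _ ≤ _ := by
        rw [← Finset.sum_mul]
        exact mul_le_mul_of_nonneg_right (sum_Ioc_inv_sq_le N) (by positivity)
  rw [hNr]
  linarith

theorem eq_of_forall_mul_eq {d : ℕ} {q r : Fin (d + 2) → ℕ} (hq : Nat.Coprime (q 0) (q 1))
    (hr : Nat.Coprime (r 0) (r 1)) (hq0 : 0 < q 0)
    (h : ∀ i k, q i * r k = q k * r i) : q = r := by
  have h01 := h 0 1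
  have h0 : q 0 = r 0 := by
    refine Nat.dvd_antisymm (hq.dvd_of_dvd_mul_left (Dvd.intro _ h01))
      (hr.dvd_of_dvd_mul_right (Dvd.intro_left _ h01.symm))
  funext k
  have := h 0 k
  rw [h0, mul_comm (q k)] at this
  exact (Nat.eq_of_mul_eq_mul_left (h0 ▸ hq0) this).symm

theorem disjoint_coprimeBlock {d s t : ℕ} (h : s < t) {q : Fin (d + 2) → ℕ}
    (hq : q ∈ coprimeBlock d s) : q ∉ coprimeBlock d t := by
  intro hq'
  obtain ⟨i, hi⟩ := (mem_coprimeBlock.1 hq').2.2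
  have h1 := ((mem_coprimeBlock.1 hq).1 i).2
  have h2 : 4 ^ (s + 1) ≤ 4 ^ t := Nat.pow_le_pow_right (by norm_num) h
  omega

/-- Almost every matrix over the circle is approximated by vectors in infinitely many blocks. -/
theorem ae_frequently_mem_coprimeBlock {d n : ℕ} {φ : ℕ → ℝ} (hφ : ∀ k, 0 < φ k)
    (hmono : Antitone φ) (hφ1 : ∀ k, φ k ≤ 1 / 2)
    (hdiv : ¬ Summable fun t : ℕ => ((4 : ℝ) ^ t) ^ (d + 2) * φ (4 ^ t) ^ n) :
    ∀ᵐ Y : Fin (d + 2) → Fin n → UnitAddCircle, ∃ᶠ t in Filter.atTop,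
      ∃ q ∈ coprimeBlock d t, ‖circleForm n q Y‖ ≤ φ (Finset.univ.sup q) := by
  let B (q : Fin (d + 2) → ℕ) : Set (Fin n → UnitAddCircle) :=
    Metric.closedBall 0 (φ (Finset.univ.sup q))
  let A (q : Fin (d + 2) → ℕ) : Set (Fin (d + 2) → Fin n → UnitAddCircle) :=
    circleForm n q ⁻¹' B q
  let f (t : ℕ) (Y : Fin (d + 2) → Fin n → UnitAddCircle) : ℝ :=
    ∑ q ∈ coprimeBlock d t, (A q).indicator (fun _ => (1 : ℝ)) Y
  have hB (q) : MeasurableSet (B q) := measurableSet_closedBall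
  have hA (q) : MeasurableSet (A q) := (continuous_circleForm n q).measurable (hB q)
  have hind (q Y) : 0 ≤ (A q).indicator (fun _ => (1 : ℝ)) Y ∧
      (A q).indicator (fun _ => (1 : ℝ)) Y ≤ 1 :=
    ⟨indicator_nonneg (fun _ _ => zero_le_one) _, indicator_le' (fun _ _ => le_rfl)
      (fun _ _ => zero_le_one) _⟩
  have hAB {t q} (hq : q ∈ coprimeBlock d t) : volume.real (A q) = volume.real (B q) := by
    rw [Measure.real, Measure.real,
      volume_preimage_circleForm ((mem_coprimeBlock.1 hq).1 0).1.ne' (hB q)]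
  have hAA {s t q r} (hq : q ∈ coprimeBlock d s) (hr : r ∈ coprimeBlock d t) (hqr : q ≠ r) :
      volume.real (A q ∩ A r) = volume.real (A q) * volume.real (A r) := by
    have : ∃ i k, q i * r k ≠ q k * r i := by
      by_contra! h
      exact hqr (eq_of_forall_mul_eq (mem_coprimeBlock.1 hq).2.1 (mem_coprimeBlock.1 hr).2.1
        ((mem_coprimeBlock.1 hq).1 0).1 h)
    obtain ⟨i, k, h⟩ := this
    rw [hAB hq, hAB hr, Measure.real, volume_preimage_circleForm_inter h (hB q) (hB r),
      ENNReal.toReal_mul]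
    rfl
  have hint (t) : ∫ Y, f t Y = ∑ q ∈ coprimeBlock d t, volume.real (A q) :=
    integral_sum_indicator volume _ hA
  have hf0 (t Y) : 0 ≤ f t Y := Finset.sum_nonneg fun q _ => (hind q Y).1
  have hfm (t) : Measurable (f t) :=
    Finset.measurable_sum _ fun q _ => measurable_const.indicator (hA q)
  have hnn (t) : 0 ≤ ∫ Y, f t Y := integral_nonneg (hf0 t)
  have hpair (s t) (hst : s ≤ t) : ∫ Y, f s Y * f t Y ≤
      1 * ((∫ Y, f s Y) * ∫ Y, f t Y) + 1 * ((1 / 2) ^ (t - s) * ∫ Y, f t Y) := by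
    have h1 : ∫ Y, f s Y * f t Y =
        ∑ q ∈ coprimeBlock d s, ∑ r ∈ coprimeBlock d t, volume.real (A q ∩ A r) :=
      integral_sum_indicator_mul volume _ _ hA hA
    have h2 : (∫ Y, f s Y) * ∫ Y, f t Y = ∑ q ∈ coprimeBlock d s, ∑ r ∈ coprimeBlock d t,
        volume.real (A q) * volume.real (A r) := by
      rw [hint, hint, Finset.sum_mul_sum]
    rw [one_mul, one_mul, h1, h2]
    rcases hst.lt_or_eq with hst | rfl
    · refine le_add_of_le_of_nonneg (le_of_eq ?_) (mul_nonneg (by positivity) (hnn t))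
      refine Finset.sum_congr rfl fun q hq => Finset.sum_congr rfl fun r hr => hAA hq hr ?_
      rintro rfl
      exact disjoint_coprimeBlock hst hq hr
    · rw [Nat.sub_self, pow_zero, one_mul, hint, ← Finset.sum_add_distrib]
      refine Finset.sum_le_sum fun q hq => ?_
      rw [← Finset.add_sum_erase _ _ hq, ← Finset.add_sum_erase _ (fun r => _ * _) hq,
        Set.inter_self,
        Finset.sum_congr rfl fun r hr =>
          hAA hq (Finset.mem_of_mem_erase hr) (Finset.ne_of_mem_erase hr).symm]
      have : 0 ≤ volume.real (A q) * volume.real (A q) := by positivity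
      linarith
  have hdiv' : ¬ Summable fun t => ∫ Y, f t Y := by
    intro hs
    refine hdiv ((summable_nat_add_iff 1).1
      ((hs.mul_left (16 / 3 / 2 ^ n)).of_nonneg_of_le (fun t => ?_) fun t => ?_))
    · have := hφ (4 ^ (t + 1))
      positivity
    · have h1 : (coprimeBlock d t).card * (2 * φ (4 ^ (t + 1))) ^ n ≤ ∫ Y, f t Y := by
        rw [hint, ← nsmul_eq_mul]
        refine Finset.card_nsmul_le_sum _ _ _ fun q hq => ?_
        rw [hAB hq, volume_closedBall_pi_unitAddCircle (hφ _).le (hφ1 _)]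
        have := hφ (4 ^ (t + 1))
        gcongr
        exact hmono (Finset.sup_le fun i _ => ((mem_coprimeBlock.1 hq).1 i).2)
      have h2 := le_card_coprimeBlock d t
      have h3 : 0 ≤ (2 * φ (4 ^ (t + 1))) ^ n := by
        have := hφ (4 ^ (t + 1))
        positivity
      rw [div_mul_eq_mul_div, le_div_iff₀ (by positivity), mul_assoc, ← mul_pow, mul_comm (φ _) 2]
      nlinarith [mul_le_mul_of_nonneg_right h2 h3]
  have hKS := inv_le_measureReal_frequently_pos volume hf0 hfm
    (fun t => ⟨_, fun Y => Finset.sum_le_card_nsmul _ _ 1 fun q _ => (hind q Y).2⟩)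
    one_pos zero_le_one hpair hdiv'
  have hmeas : MeasurableSet {Y | ∃ᶠ t in Filter.atTop, 0 < f t Y} := by
    have : {Y | ∃ᶠ t in Filter.atTop, 0 < f t Y} = ⋂ N : ℕ, ⋃ t ≥ N, {Y | 0 < f t Y} := by
      ext Y
      simp [Filter.frequently_atTop]
    rw [this]
    exact MeasurableSet.iInter fun N => MeasurableSet.iUnion fun t => MeasurableSet.iUnion fun _ =>
      measurableSet_lt measurable_const (hfm t)
  have hone : volume {Y | ∃ᶠ t in Filter.atTop, 0 < f t Y} = 1 := by
    refine le_antisymm prob_le_one ?_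
    rw [inv_one] at hKS
    rw [← ENNReal.ofReal_one]
    exact ENNReal.ofReal_le_of_le_toReal hKS
  filter_upwards [(mem_ae_iff_prob_eq_one hmeas).2 hone] with Y hY
  refine Filter.Frequently.mono hY fun t ht => ?_
  obtain ⟨q, hq, hqY⟩ := Finset.exists_ne_zero_of_sum_ne_zero ht.ne'
  have : Y ∈ A q := by
    by_contra h
    exact hqY (indicator_of_notMem h _)
  exact ⟨q, hq, mem_closedBall_zero_iff.1 this⟩

theorem nint_le_abs_sub (ξ : ℝ) (p : ℤ) : nint ξ ≤ |ξ - p| :=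
  ciInf_le (f := fun p : ℤ => |ξ - (p : ℝ)|) ⟨0, by rintro _ ⟨p, rfl⟩; exact abs_nonneg _⟩ p

theorem supNint_le {n : ℕ} (hn : 1 ≤ n) {u : Fin n → ℝ} {δ : ℝ}
    (h : ∀ j, ∃ p : ℤ, |u j - p| ≤ δ) : supNint u ≤ δ := by
  have : Nonempty (Fin n) := ⟨⟨0, hn⟩⟩
  refine ciSup_le fun j => ?_
  obtain ⟨p, hp⟩ := h j
  exact (nint_le_abs_sub _ p).trans hp

theorem supNorm_natCast {m : ℕ} (q : Fin m → ℕ) :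
    supNorm (fun i => (q i : ℤ)) = Finset.univ.sup q := by
  simp [supNorm]

theorem infinite_of_forall_exists_lt_supNorm {m : ℕ} {S : Set (Fin m → ℤ)}
    (h : ∀ N, ∃ q ∈ S, N < supNorm q) : S.Infinite := by
  refine Set.Infinite.of_image supNorm (Set.infinite_of_not_bddAbove ?_)
  rintro ⟨N, hN⟩
  obtain ⟨q, hq, hlt⟩ := h N
  exact (hN (mem_image_of_mem _ hq)).not_gt hlt

theorem volume_Wmn_eq_one_of_ae {m n : ℕ} {ψ : ℕ → ℝ}
    (h : ∀ᵐ X : Fin m → Fin n → ℝ ∂volume.restrict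
        (univ.pi fun _ => univ.pi fun _ => Ioc (0 : ℝ) 1),
      ∀ N, ∃ q : Fin m → ℕ, N < Finset.univ.sup q ∧
        supNint (fun j => ∑ i, (q i : ℝ) * X i j) < ψ (Finset.univ.sup q)) :
    volume (Wmn m n ψ) = 1 := by
  have hcube (I : Set ℝ) (hI : volume I = 1) :
      volume (univ.pi fun _ : Fin m => univ.pi fun _ : Fin n => I) = 1 := by
    rw [volume_pi_pi]
    refine Finset.prod_eq_one fun i _ => ?_
    rw [volume_pi_pi]
    exact Finset.prod_eq_one fun j _ => hI
  refine le_antisymm ?_ ?_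
  · rw [← hcube (Icc 0 1) (by simp)]
    exact measure_mono fun X hX i _ j _ => hX.1 i j
  · rw [← hcube (Ioc 0 1) (by simp)]
    refine measure_mono_ae ?_
    rw [ae_restrict_iff' (MeasurableSet.univ_pi fun _ => MeasurableSet.univ_pi fun _ =>
      measurableSet_Ioc)] at h
    filter_upwards [h] with X hX hXI
    refine ⟨fun i j => Ioc_subset_Icc_self (hXI i trivial j trivial),
      infinite_of_forall_exists_lt_supNorm fun N => ?_⟩
    obtain ⟨q, hN, hq⟩ := hX hXI N
    refine ⟨fun i => (q i : ℤ), ⟨?_, ?_⟩, ?_⟩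
    · intro h0
      have : Finset.univ.sup q = 0 := by
        rw [← supNorm_natCast, h0]
        simp [supNorm]
      omega
    · rw [supNorm_natCast]
      simpa only [Int.cast_natCast] using hq
    · rwa [supNorm_natCast]

theorem measurePreserving_coe_unitAddCircle (m n : ℕ) :
    MeasurePreserving (fun (X : Fin m → Fin n → ℝ) i j => (X i j : UnitAddCircle))
      (volume.restrict (univ.pi fun _ => univ.pi fun _ => Ioc (0 : ℝ) 1)) volume := by
  have h1 : MeasurePreserving ((↑) : ℝ → UnitAddCircle) (volume.restrict (Ioc 0 1)) volume := by
    simpa using UnitAddCircle.measurePreserving_mk 0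
  have h2 := measurePreserving_pi (fun _ : Fin n => volume.restrict (Ioc (0 : ℝ) 1))
    (fun _ => (volume : Measure UnitAddCircle)) (fun _ => h1)
  rw [← Measure.restrict_pi_pi] at h2
  have h3 := measurePreserving_pi
    (fun _ : Fin m => (volume : Measure (Fin n → ℝ)).restrict (univ.pi fun _ => Ioc (0 : ℝ) 1))
    (fun _ => (volume : Measure (Fin n → UnitAddCircle))) (fun _ => h2)
  rw [← Measure.restrict_pi_pi] at h3
  exact h3

theorem volume_Wmn_one_eq_one {n : ℕ} (hn : 1 ≤ n) {φ ψ : ℕ → ℝ} (hφ : ∀ k, 0 < φ k)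
    (hmono : Antitone φ) (hφ1 : ∀ k, φ k ≤ 1 / 2) (hφψ : ∀ k, φ k < ψ k)
    (hdiv : ¬ Summable fun k : ℕ => (k : ℝ) ^ (1 - 1) * φ k ^ n) :
    volume (Wmn 1 n ψ) = 1 := by
  have hae := ae_mem_simApprox hn hφ hmono (fun k => (hφ1 k).trans (by norm_num)) (by
    simpa only [pow_one] using
      not_summable_condensed (b := 2 ^ n) (Nat.le_self_pow (by omega) 2) le_rfl hφ hmono hdiv)
  refine volume_Wmn_eq_one_of_ae (ae_restrict_of_ae ?_)
  filter_upwards [(volume_preserving_funUnique (Fin 1) (Fin n → ℝ)).quasiMeasurePreserving.ae hae]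
    with X hX N
  obtain ⟨k, hk, p, hp⟩ := Filter.frequently_atTop.1 hX (N + 1)
  have hsup : Finset.univ.sup (fun _ : Fin 1 => k) = k := by simp
  refine ⟨fun _ => k, by rw [hsup]; omega, ?_⟩
  rw [hsup]
  refine (supNint_le hn fun j => ⟨p j, ?_⟩).trans_lt (hφψ k)
  simpa using hp j

theorem volume_Wmn_add_two_eq_one {d n : ℕ} (hn : 1 ≤ n) {φ ψ : ℕ → ℝ} (hφ : ∀ k, 0 < φ k)
    (hmono : Antitone φ) (hφ1 : ∀ k, φ k ≤ 1 / 2) (hφψ : ∀ k, φ k < ψ k)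
    (hdiv : ¬ Summable fun k : ℕ => (k : ℝ) ^ (d + 2 - 1) * φ k ^ n) :
    volume (Wmn (d + 2) n ψ) = 1 := by
  have hae := ae_frequently_mem_coprimeBlock hφ hmono hφ1 (by
    simpa using not_summable_condensed (b := 4) (by norm_num) (by omega) hφ hmono hdiv)
  refine volume_Wmn_eq_one_of_ae ?_
  filter_upwards [(measurePreserving_coe_unitAddCircle (d + 2) n).quasiMeasurePreserving.ae hae]
    with X hX N
  obtain ⟨t, ht, q, hq, hqX⟩ := Filter.frequently_atTop.1 hX N
  obtain ⟨i, hi⟩ := (mem_coprimeBlock.1 hq).2.2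
  refine ⟨q, ?_, (supNint_le hn fun j => ⟨round (∑ i, (q i : ℝ) * X i j), ?_⟩).trans_lt (hφψ _)⟩
  · exact ht.trans_lt ((Nat.lt_pow_self (by norm_num)).trans
      (hi.trans_le (Finset.le_sup (f := q) (Finset.mem_univ i))))
  · rw [← UnitAddCircle.norm_eq, ← circleForm_coe]
    exact (norm_le_pi_norm _ j).trans hqX

/-- **Khintchine–Groshev theorem, divergence case**: if `ψ` is non-increasing
and `∑ k^{m-1} ψ(k)^n = ∞`, then `W(ψ; m, n)` has `mn`-dimensional Lebesgue
measure 1. -/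
theorem khintchine_groshev_divergence (m n : ℕ) (hm : 1 ≤ m) (hn : 1 ≤ n)
    (ψ : ℕ → ℝ) (hψ : ∀ k, 0 < ψ k) (hmono : Antitone ψ)
    (hdiv : ¬ Summable fun k : ℕ => (k : ℝ) ^ (m - 1) * ψ k ^ n) :
    volume (Wmn m n ψ) = 1 := by
  obtain ⟨δ, hδ0, hδ1, hδψ⟩ : ∃ δ : ℝ, 0 < δ ∧ δ < 1 ∧ δ * ψ 0 ≤ 1 / 2 := by
    refine ⟨min (1 / 2) (1 / 2 / ψ 0), lt_min (by norm_num) (div_pos (by norm_num) (hψ 0)),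
      (min_le_left _ _).trans_lt (by norm_num), ?_⟩
    exact (mul_le_mul_of_nonneg_right (min_le_right _ _) (hψ 0).le).trans
      (div_mul_cancel₀ _ (hψ 0).ne').le
  have hφ (k) : 0 < δ * ψ k := mul_pos hδ0 (hψ k)
  have hφmono : Antitone fun k => δ * ψ k := fun _ _ h =>
    mul_le_mul_of_nonneg_left (hmono h) hδ0.le
  have hφ1 (k) : δ * ψ k ≤ 1 / 2 := (hφmono (Nat.zero_le k)).trans hδψ
  have hφψ (k) : δ * ψ k < ψ k := mul_lt_of_lt_one_left (hψ k) hδ1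
  have hφdiv : ¬ Summable fun k : ℕ => (k : ℝ) ^ (m - 1) * (δ * ψ k) ^ n := by
    intro hs
    refine hdiv ((hs.mul_left (δ ^ n)⁻¹).congr fun k => ?_)
    rw [mul_pow]
    field_simp
  match m, hm with
  | 1, _ => exact volume_Wmn_one_eq_one hn hφ hφmono hφ1 hφψ hφdiv
  | d + 2, _ => exact volume_Wmn_add_two_eq_one hn hφ hφmono hφ1 hφψ hφdiv
end

section
/- Let ψ : ℕ → (0,∞) and let W(ψ) := {u ∈ [0,1]² : ‖q·u‖ < ψ(|q|) for infinitely many q ∈ ℤ² \ {0}}, where ‖ξ‖ is the distance from ξ ∈ ℝ to the nearest integer and |q| = max{|q₁|,|q₂|}. Then W(ψ) has planar Lebesgue measure 0 if ∑_{k=1}^∞ k ψ(k) < ∞, and planar Lebesgue measure 1 if ∑_{k=1}^∞ k ψ(k) = ∞ and ψ is non-increasing. -/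
open MeasureTheory Set

/-- The set of `ψ`-approximable points of the unit square (dual form):
`‖q·u‖ < ψ(|q|)` for infinitely many nonzero `q ∈ ℤ²`,
where `|q| = max{|q₁|, |q₂|}`. -/
def W2 (ψ : ℕ → ℝ) : Set (ℝ × ℝ) :=
  {u | u.1 ∈ Icc (0 : ℝ) 1 ∧ u.2 ∈ Icc (0 : ℝ) 1 ∧
    {q : ℤ × ℤ | q ≠ 0 ∧
      nint ((q.1 : ℝ) * u.1 + (q.2 : ℝ) * u.2) <
        ψ (max q.1.natAbs q.2.natAbs)}.Infinite}

open ProbabilityTheory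

theorem measure_setOf_finite_eq_zero_of_pairwise_indepFun_indicator {Ω ι : Type*}
    [MeasurableSpace Ω] {μ : Measure Ω} [IsProbabilityMeasure μ] {E : ι → Set Ω}
    (hE : ∀ i, MeasurableSet (E i))
    (hind : Pairwise fun i j =>
      IndepFun ((E i).indicator (1 : Ω → ℝ)) ((E j).indicator (1 : Ω → ℝ)) μ)
    (hsum : ¬ Summable fun i => μ.real (E i)) :
    μ {ω | {i | ω ∈ E i}.Finite} = 0 := by
  classical
  set X : ι → Ω → ℝ := fun i => (E i).indicator 1 with hX
  have hX2 : ∀ i, MemLp (X i) 2 μ := fun i =>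
    memLp_indicator_const 2 (hE i) 1 (Or.inr (measure_ne_top _ _))
  have hmean : ∀ i, ∫ ω, X i ω ∂μ = μ.real (E i) := fun i => integral_indicator_one (hE i)
  have hvar : ∀ i, Var[X i; μ] ≤ μ.real (E i) := fun i => by
    refine (variance_le_expectation_sq (hX2 i).1).trans_eq ?_
    rw [← hmean]
    congr 1
    ext ω
    by_cases h : ω ∈ E i <;> simp [hX, h]
  have hbound : ∀ (M : ℕ) (s : Finset ι), (2 * M : ℝ) ≤ ∑ i ∈ s, μ.real (E i) →
      0 < ∑ i ∈ s, μ.real (E i) →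
      μ {ω | ∀ t : Finset ι, ∑ i ∈ t, X i ω ≤ M} ≤
        ENNReal.ofReal (4 / ∑ i ∈ s, μ.real (E i)) := by
    intro M s hM hpos
    set m := ∑ i ∈ s, μ.real (E i)
    have hmem : MemLp (∑ i ∈ s, X i) 2 μ := memLp_finsetSum' s fun i _ => hX2 i
    have hint : ∫ ω, (∑ i ∈ s, X i) ω ∂μ = m := by
      simp only [Finset.sum_apply]
      rw [integral_finsetSum _ fun i _ => (hX2 i).integrable one_le_two]
      exact Finset.sum_congr rfl fun i _ => hmean i
    have hv : Var[∑ i ∈ s, X i; μ] ≤ m := by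
      rw [IndepFun.variance_sum (fun i _ => hX2 i) fun i _ j _ hij => hind hij]
      exact Finset.sum_le_sum fun i _ => hvar i
    calc μ {ω | ∀ t : Finset ι, ∑ i ∈ t, X i ω ≤ M}
        ≤ μ {ω | m / 2 ≤ |(∑ i ∈ s, X i) ω - ∫ ω, (∑ i ∈ s, X i) ω ∂μ|} := by
          refine measure_mono fun ω hω => ?_
          have h1 : ∑ i ∈ s, X i ω ≤ M := hω s
          rw [Set.mem_ofPred_eq, hint, Finset.sum_apply, abs_sub_comm]
          exact le_trans (by linarith) (le_abs_self _)
      _ ≤ ENNReal.ofReal (Var[∑ i ∈ s, X i; μ] / (m / 2) ^ 2) :=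
          meas_ge_le_variance_div_sq hmem (by positivity)
      _ ≤ ENNReal.ofReal (4 / m) := by
          apply ENNReal.ofReal_le_ofReal
          calc Var[∑ i ∈ s, X i; μ] / (m / 2) ^ 2 ≤ m / (m / 2) ^ 2 := by gcongr
            _ = 4 / m := by field_simp; norm_num
  have hlarge : ∀ c : ℝ, ∃ s : Finset ι, c < ∑ i ∈ s, μ.real (E i) := by
    by_contra! h
    obtain ⟨c, hc⟩ := h
    exact hsum (summable_of_sum_le (fun i => measureReal_nonneg) hc)
  have hzero : ∀ M : ℕ, μ {ω | ∀ t : Finset ι, ∑ i ∈ t, X i ω ≤ M} = 0 := by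
    intro M
    refine le_antisymm (ENNReal.le_of_forall_pos_le_add fun ε hε _ => ?_) bot_le
    obtain ⟨s, hs⟩ := hlarge (max (2 * M) (4 / ε))
    have h1 := (le_max_left _ _).trans hs.le
    have h2 := (le_max_right _ _).trans hs.le
    have hε' : (0 : ℝ) < ε := hε
    have h3 : 0 < ∑ i ∈ s, μ.real (E i) := lt_of_lt_of_le (by positivity) h2
    refine (hbound M s h1 h3).trans ?_
    rw [zero_add, ← ENNReal.ofReal_coe_nnreal]
    apply ENNReal.ofReal_le_ofReal
    rw [div_le_iff₀ hε'] at h2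
    rw [div_le_iff₀ h3]
    linarith
  refine measure_mono_null (fun ω hω => ?_) (measure_iUnion_null hzero)
  have hω' : {i | ω ∈ E i}.Finite := hω
  refine mem_iUnion.2 ⟨hω'.toFinset.card, fun t => ?_⟩
  have hcount : ∑ i ∈ t, X i ω = ({i ∈ t | ω ∈ E i}.card : ℝ) := by
    simp [hX, Set.indicator_apply]
  rw [hcount]
  exact_mod_cast Finset.card_le_card fun i hi => by simpa using (Finset.mem_filter.1 hi).2

theorem half_le_sum_totient_div (N : ℕ) :
    (N : ℝ) / 2 ≤ ∑ d ∈ Finset.Ioc 0 N, (d.totient : ℝ) / d := by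
  rcases N.eq_zero_or_pos with rfl | hN
  · simp
  have key : ∑ n ∈ Finset.Ioc 0 N, n = ∑ d ∈ Finset.Ioc 0 N, d.totient * (N / d) := by
    calc ∑ n ∈ Finset.Ioc 0 N, n
        = ∑ n ∈ Finset.Ioc 0 N, ∑ d ∈ Finset.Ioc 0 N, if d ∣ n then d.totient else 0 := by
          refine Finset.sum_congr rfl fun n hn => ?_
          rw [Finset.mem_Ioc] at hn
          conv_lhs => rw [← Nat.sum_totient n]
          rw [← Finset.sum_filter]
          refine Finset.sum_congr ?_ fun _ _ => rfl
          ext d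
          simp only [Nat.mem_divisors, Finset.mem_filter, Finset.mem_Ioc]
          exact ⟨fun h => ⟨⟨Nat.pos_of_dvd_of_pos h.1 hn.1, (Nat.le_of_dvd hn.1 h.1).trans hn.2⟩,
            h.1⟩, fun h => ⟨h.2, hn.1.ne'⟩⟩
      _ = ∑ d ∈ Finset.Ioc 0 N, d.totient * (N / d) := by
          rw [Finset.sum_comm]
          refine Finset.sum_congr rfl fun d _ => ?_
          rw [← Finset.sum_filter, Finset.sum_const, Nat.Ioc_filter_dvd_card_eq_div, smul_eq_mul,
            mul_comm]
  have hgauss : ((∑ n ∈ Finset.Ioc 0 N, n : ℕ) : ℝ) = N * (N + 1) / 2 := by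
    clear key hN
    induction N with
    | zero => simp
    | succ k ih =>
      rw [Finset.sum_Ioc_succ_top (Nat.zero_le k)]
      push_cast at ih ⊢
      rw [ih]; ring
  have hN' : (0 : ℝ) < N := by exact_mod_cast hN
  have : (N : ℝ) * (N + 1) / 2 ≤ N * ∑ d ∈ Finset.Ioc 0 N, (d.totient : ℝ) / d := by
    rw [← hgauss, key, Finset.mul_sum]
    push_cast
    refine Finset.sum_le_sum fun d _ => ?_
    calc (d.totient : ℝ) * ((N / d : ℕ) : ℝ) ≤ d.totient * ((N : ℝ) / d) := by
          gcongr; exact Nat.cast_div_le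
      _ = N * ((d.totient : ℝ) / d) := by ring
  nlinarith

theorem sq_le_sum_totient_Ioc (N : ℕ) :
    (N : ℝ) ^ 2 ≤ ∑ d ∈ Finset.Ioc N (4 * N), (d.totient : ℝ) := by
  rcases N.eq_zero_or_pos with rfl | hN
  · simp
  have h1 := half_le_sum_totient_div (4 * N)
  rw [← Finset.sum_Ioc_consecutive _ (Nat.zero_le N) (by omega : N ≤ 4 * N)] at h1
  have h2 : ∑ d ∈ Finset.Ioc 0 N, (d.totient : ℝ) / d ≤ N := by
    calc ∑ d ∈ Finset.Ioc 0 N, (d.totient : ℝ) / d ≤ ∑ d ∈ Finset.Ioc 0 N, 1 :=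
          Finset.sum_le_sum fun d _ => div_le_one_of_le₀ (by exact_mod_cast d.totient_le)
            d.cast_nonneg
      _ = N := by simp
  have hN' : (0 : ℝ) < N := by exact_mod_cast hN
  have h3 : ∑ d ∈ Finset.Ioc N (4 * N), (d.totient : ℝ) / d ≤
      (∑ d ∈ Finset.Ioc N (4 * N), (d.totient : ℝ)) / N := by
    rw [Finset.sum_div]
    refine Finset.sum_le_sum fun d hd => ?_
    have : (N : ℝ) ≤ d := by exact_mod_cast (Finset.mem_Ioc.1 hd).1.le
    gcongr
  push_cast at h1
  rw [sq, ← le_div_iff₀ hN']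
  linarith

theorem summable_nat_mul_of_summable_totient_mul {f : ℕ → ℝ} (hf : Antitone f)
    (hf0 : ∀ k, 0 ≤ f k) (hs : Summable fun k : ℕ => (k.totient : ℝ) * f k) :
    Summable fun k : ℕ => (k : ℝ) * f k := by
  have hφ0 : ∀ k : ℕ, 0 ≤ (k.totient : ℝ) * f k := fun k =>
    mul_nonneg k.totient.cast_nonneg (hf0 k)
  have hk0 : ∀ k : ℕ, 0 ≤ (k : ℝ) * f k := fun k => mul_nonneg k.cast_nonneg (hf0 k)
  have hblock : ∀ N : ℕ, ∑ k ∈ Finset.Ioc (4 * N) (4 * (4 * N)), (k : ℝ) * f k ≤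
      256 * ∑ k ∈ Finset.Ioc N (4 * N), (k.totient : ℝ) * f k := by
    intro N
    have h1 : ∑ k ∈ Finset.Ioc (4 * N) (4 * (4 * N)), (k : ℝ) * f k ≤
        256 * ((N : ℝ) ^ 2 * f (4 * N)) := by
      calc ∑ k ∈ Finset.Ioc (4 * N) (4 * (4 * N)), (k : ℝ) * f k
          ≤ ∑ k ∈ Finset.Ioc (4 * N) (4 * (4 * N)), (16 * N : ℝ) * f (4 * N) := by
            refine Finset.sum_le_sum fun k hk => ?_
            rw [Finset.mem_Ioc] at hk
            have hk' : (k : ℝ) ≤ 16 * N := by exact_mod_cast (by omega : k ≤ 16 * N)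
            exact mul_le_mul hk' (hf hk.1.le) (hf0 k) (by positivity)
        _ = ((4 * (4 * N) - 4 * N : ℕ) : ℝ) * ((16 * N : ℝ) * f (4 * N)) := by simp
        _ ≤ (16 * N : ℝ) * ((16 * N : ℝ) * f (4 * N)) := by
            have : ((4 * (4 * N) - 4 * N : ℕ) : ℝ) ≤ 16 * N := by
              exact_mod_cast (by omega : 4 * (4 * N) - 4 * N ≤ 16 * N)
            exact mul_le_mul_of_nonneg_right this (mul_nonneg (by positivity) (hf0 _))
        _ = 256 * ((N : ℝ) ^ 2 * f (4 * N)) := by ring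
    have h2 : (N : ℝ) ^ 2 * f (4 * N) ≤ ∑ k ∈ Finset.Ioc N (4 * N), (k.totient : ℝ) * f k := by
      calc (N : ℝ) ^ 2 * f (4 * N)
          ≤ (∑ k ∈ Finset.Ioc N (4 * N), (k.totient : ℝ)) * f (4 * N) :=
            mul_le_mul_of_nonneg_right (sq_le_sum_totient_Ioc N) (hf0 _)
        _ ≤ ∑ k ∈ Finset.Ioc N (4 * N), (k.totient : ℝ) * f k := by
            rw [Finset.sum_mul]
            exact Finset.sum_le_sum fun k hk => mul_le_mul_of_nonneg_left
              (hf (Finset.mem_Ioc.1 hk).2) k.totient.cast_nonneg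
    linarith
  have hpow : ∀ n : ℕ, ∑ k ∈ Finset.Ioc (4 : ℕ) (4 * 4 ^ n), (k : ℝ) * f k ≤
      256 * ∑ k ∈ Finset.Ioc (1 : ℕ) (4 ^ n), (k.totient : ℝ) * f k := by
    intro n
    induction n with
    | zero => simp
    | succ n ih =>
      have h1 : 1 ≤ 4 ^ n := Nat.one_le_pow _ _ (by norm_num)
      rw [pow_succ', ← Finset.sum_Ioc_consecutive _ (by omega : 4 ≤ 4 * 4 ^ n)
          (by omega : 4 * 4 ^ n ≤ 4 * (4 * 4 ^ n)),
        ← Finset.sum_Ioc_consecutive _ h1 (by omega : 4 ^ n ≤ 4 * 4 ^ n)]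
      linarith [hblock (4 ^ n)]
  refine summable_of_sum_range_le (c := ∑ k ∈ Finset.range 5, (k : ℝ) * f k +
    256 * ∑' k : ℕ, (k.totient : ℝ) * f k) hk0 fun n => ?_
  have hn : n < 4 ^ n := Nat.lt_pow_self (by norm_num)
  calc ∑ k ∈ Finset.range n, (k : ℝ) * f k
      ≤ ∑ k ∈ Finset.range 5 ∪ Finset.Ioc 4 (4 * 4 ^ n), (k : ℝ) * f k := by
        refine Finset.sum_le_sum_of_subset_of_nonneg (fun k hk => ?_) fun k _ _ => hk0 k
        simp only [Finset.mem_union, Finset.mem_range, Finset.mem_Ioc] at hk ⊢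
        omega
    _ = ∑ k ∈ Finset.range 5, (k : ℝ) * f k +
        ∑ k ∈ Finset.Ioc (4 : ℕ) (4 * 4 ^ n), (k : ℝ) * f k := by
        refine Finset.sum_union (Finset.disjoint_left.2 fun k hk hk' => ?_)
        simp only [Finset.mem_range, Finset.mem_Ioc] at hk hk'
        omega
    _ ≤ _ := by
        have := hs.sum_le_tsum (Finset.Ioc 1 (4 ^ n)) fun k _ => hφ0 k
        linarith [hpow n]

theorem not_summable_nat_mul_min {f : ℕ → ℝ} (hf : Antitone f) {c : ℝ} (hc : 0 < c)
    (hs : ¬ Summable fun k : ℕ => (k : ℝ) * f k) :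
    ¬ Summable fun k : ℕ => (k : ℝ) * min (f k) c := by
  by_cases h : ∃ N, f N < c
  · obtain ⟨N, hN⟩ := h
    intro hs'
    refine hs ((summable_congr_atTop ?_).1 hs')
    filter_upwards [Filter.eventually_ge_atTop N] with k hk
    rw [min_eq_left ((hf hk).trans hN.le)]
  · push Not at h
    intro hs'
    have h0 := hs'.tendsto_atTop_zero
    simp only [min_eq_right (h _)] at h0
    exact not_tendsto_nhds_of_tendsto_atTop
      (tendsto_natCast_atTop_atTop.atTop_mul_const hc) 0 h0

theorem nint_eq_norm (ξ : ℝ) : nint ξ = ‖(ξ : UnitAddCircle)‖ := by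
  rw [UnitAddCircle.norm_eq]
  exact le_antisymm (ciInf_le ⟨0, by rintro _ ⟨p, rfl⟩; exact abs_nonneg _⟩ _)
    (le_ciInf fun p => round_le ξ p)

/-- The character `x ↦ q·x` of the two-dimensional torus. -/
noncomputable def torusChar (q : ℤ × ℤ) : UnitAddCircle × UnitAddCircle →+ UnitAddCircle :=
  q.1 • AddMonoidHom.fst _ _ + q.2 • AddMonoidHom.snd _ _

theorem torusChar_apply (q : ℤ × ℤ) (x : UnitAddCircle × UnitAddCircle) :
    torusChar q x = q.1 • x.1 + q.2 • x.2 := rfl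

theorem continuous_torusChar (q : ℤ × ℤ) : Continuous (torusChar q) :=
  (continuous_fst.zsmul q.1).add (continuous_snd.zsmul q.2)

theorem surjective_torusChar_prod {q r : ℤ × ℤ} (h : q.1 * r.2 - q.2 * r.1 ≠ 0) :
    Function.Surjective ((torusChar q).prod (torusChar r)) := by
  rintro ⟨x, y⟩
  induction x using QuotientAddGroup.induction_on with | H x => ?_
  induction y using QuotientAddGroup.induction_on with | H y => ?_
  have hD : ((q.1 : ℝ) * r.2 - q.2 * r.1) ≠ 0 := by exact_mod_cast h
  set D : ℝ := (q.1 : ℝ) * r.2 - q.2 * r.1 with hDdef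
  refine ⟨((((r.2 * x - q.2 * y) / D : ℝ) : UnitAddCircle),
    (((q.1 * y - r.1 * x) / D : ℝ) : UnitAddCircle)), ?_⟩
  rw [AddMonoidHom.prod_apply, torusChar_apply, torusChar_apply]
  simp only [← AddCircle.coe_zsmul, ← AddCircle.coe_add, zsmul_eq_mul]
  refine Prod.ext (congrArg ((↑) : ℝ → UnitAddCircle) ?_)
    (congrArg ((↑) : ℝ → UnitAddCircle) ?_)
  · field_simp
    rw [hDdef]; ring
  · field_simp
    rw [hDdef]; ring

instance : IsProbabilityMeasure (volume : Measure UnitAddCircle) :=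
  ⟨UnitAddCircle.measure_univ⟩

instance : ((volume : Measure UnitAddCircle).prod
    (volume : Measure UnitAddCircle)).IsAddHaarMeasure :=
  Measure.prod.instIsAddHaarMeasure _ _

theorem measurePreserving_torusChar_prod {q r : ℤ × ℤ} (h : q.1 * r.2 - q.2 * r.1 ≠ 0) :
    MeasurePreserving (fun x => (torusChar q x, torusChar r x))
      ((volume : Measure UnitAddCircle).prod volume)
      ((volume : Measure UnitAddCircle).prod volume) :=
  AddMonoidHom.measurePreserving (f := (torusChar q).prod (torusChar r))
    ((continuous_torusChar q).prodMk (continuous_torusChar r)) (surjective_torusChar_prod h) rfl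

theorem measurePreserving_torusChar {q : ℤ × ℤ} (hq : q ≠ 0) :
    MeasurePreserving (torusChar q) ((volume : Measure UnitAddCircle).prod volume) volume := by
  refine measurePreserving_fst.comp
    (measurePreserving_torusChar_prod (q := q) (r := (-q.2, q.1)) fun h => hq ?_)
  have h' : q.1 * q.1 + q.2 * q.2 = 0 := by
    rw [← h]; ring
  obtain ⟨h1, h2⟩ := mul_self_add_mul_self_eq_zero.1 h'
  exact Prod.ext_iff.2 ⟨h1, h2⟩

theorem indepFun_torusChar {q r : ℤ × ℤ} (h : q.1 * r.2 - q.2 * r.1 ≠ 0) :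
    IndepFun (torusChar q) (torusChar r) ((volume : Measure UnitAddCircle).prod volume) := by
  have hq : q ≠ 0 := by rintro rfl; simp at h
  have hr : r ≠ 0 := by rintro rfl; simp at h
  rw [indepFun_iff_map_prod_eq_prod_map_map (measurePreserving_torusChar hq).aemeasurable
    (measurePreserving_torusChar hr).aemeasurable, (measurePreserving_torusChar hq).map_eq,
    (measurePreserving_torusChar hr).map_eq, (measurePreserving_torusChar_prod h).map_eq]

theorem measure_torusChar_norm_le {q : ℤ × ℤ} (hq : q ≠ 0) (δ : ℝ) :
    ((volume : Measure UnitAddCircle).prod volume) (torusChar q ⁻¹' Metric.closedBall 0 δ) =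
      ENNReal.ofReal (min 1 (2 * δ)) := by
  rw [(measurePreserving_torusChar hq).measure_preimage
    measurableSet_closedBall.nullMeasurableSet, AddCircle.volume_closedBall]

/-- The integer vectors `q` with `‖q·x‖ < ψ(|q|)`, for a point `x` of the torus. -/
def approxVectors (ψ : ℕ → ℝ) (x : UnitAddCircle × UnitAddCircle) : Set (ℤ × ℤ) :=
  {q | q ≠ 0 ∧ ‖torusChar q x‖ < ψ (max q.1.natAbs q.2.natAbs)}

theorem summable_comp_max_natAbs {f : ℕ → ℝ} (hf0 : ∀ k, 0 ≤ f k)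
    (hs : Summable fun k : ℕ => (k : ℝ) * f k) :
    Summable fun q : ℤ × ℤ => f (max q.1.natAbs q.2.natAbs) := by
  rw [summable_partition (fun q => hf0 _) Int.existsUnique_mem_box]
  refine ⟨fun n => (hasSum_fintype (β := Finset.box (α := ℤ × ℤ) n) _).summable, ?_⟩
  refine (summable_congr_atTop ?_).1 (hs.mul_left 8)
  filter_upwards [Filter.eventually_ge_atTop 1] with n hn
  have hval : ∀ q : Finset.box (α := ℤ × ℤ) n, f (max q.1.1.natAbs q.1.2.natAbs) = f n :=
    fun q => by rw [Int.mem_box.1 q.2]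
  refine Eq.trans ?_ (tsum_congr hval).symm
  rw [tsum_fintype]
  simp [Int.card_box (by omega : n ≠ 0), mul_assoc]

theorem ae_finite_approxVectors {ψ : ℕ → ℝ} (hψ : ∀ k, 0 ≤ ψ k)
    (hs : Summable fun k : ℕ => (k : ℝ) * ψ k) :
    ∀ᵐ x ∂(volume : Measure UnitAddCircle).prod volume, (approxVectors ψ x).Finite := by
  refine ae_finite_setOfPred_mem
    (s := fun q : ℤ × ℤ => {x | q ≠ 0 ∧ ‖torusChar q x‖ < ψ (max q.1.natAbs q.2.natAbs)})
    (ne_top_of_le_ne_top ((summable_comp_max_natAbs hψ hs).mul_left 2).tsum_ofReal_ne_top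
      (ENNReal.tsum_le_tsum fun q => ?_))
  by_cases hq : q = 0
  · simp [hq]
  · refine (measure_mono fun x hx => ?_).trans
      ((measure_torusChar_norm_le hq (ψ (max q.1.natAbs q.2.natAbs))).trans_le
        (ENNReal.ofReal_le_ofReal (min_le_right _ _)))
    exact mem_closedBall_zero_iff.2 hx.2.le

theorem eq_of_coprime_of_mul_eq_mul {a k b l : ℕ} (hk : k.Coprime a) (hl : l.Coprime b)
    (h : a * l = k * b) : k = l ∧ a = b := by
  have hkl : k ∣ l := hk.dvd_of_dvd_mul_left (h ▸ dvd_mul_right k b)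
  have hlk : l ∣ k := hl.dvd_of_dvd_mul_right (h ▸ dvd_mul_left l a)
  obtain rfl := Nat.dvd_antisymm hkl hlk
  refine ⟨rfl, ?_⟩
  rcases k.eq_zero_or_pos with rfl | hpos
  · simp_all
  · exact Nat.eq_of_mul_eq_mul_left hpos (by rw [← h, mul_comm])

theorem ae_infinite_approxVectors {ψ : ℕ → ℝ} (hψ : ∀ k, 0 < ψ k)
    (hs : ¬ Summable fun k : ℕ => (k : ℝ) * ψ k) (hanti : Antitone ψ) :
    ∀ᵐ x ∂(volume : Measure UnitAddCircle).prod volume, (approxVectors ψ x).Infinite := by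
  let vec : (Σ k : ℕ, {a // a ∈ (Finset.range k).filter k.Coprime}) → ℤ × ℤ :=
    fun i => ((i.2.1 : ℤ), (i.1 : ℤ))
  have hlt : ∀ i : (Σ k : ℕ, {a // a ∈ (Finset.range k).filter k.Coprime}), i.2.1 < i.1 :=
    fun i => Finset.mem_range.1 (Finset.mem_filter.1 i.2.2).1
  have hvec0 : ∀ i, vec i ≠ 0 := fun i h => by
    have h2 : (i.1 : ℤ) = 0 := congrArg Prod.snd h
    have := hlt i
    omega
  have hinj : Function.Injective vec := by
    rintro ⟨k, a, ha⟩ ⟨l, b, hb⟩ h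
    obtain ⟨h1, h2⟩ : (a : ℤ) = b ∧ (k : ℤ) = l := Prod.ext_iff.1 h
    obtain rfl := Int.ofNat.inj h1
    obtain rfl := Int.ofNat.inj h2
    rfl
  have hdet : ∀ i j, i ≠ j → (vec i).1 * (vec j).2 - (vec i).2 * (vec j).1 ≠ 0 := by
    intro i j hij h
    refine hij (hinj ?_)
    have h' : i.2.1 * j.1 = i.1 * j.2.1 := by
      have h'' : (i.2.1 : ℤ) * j.1 = i.1 * j.2.1 := sub_eq_zero.1 h
      exact_mod_cast h''
    obtain ⟨h1, h2⟩ := eq_of_coprime_of_mul_eq_mul (Finset.mem_filter.1 i.2.2).2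
      (Finset.mem_filter.1 j.2.2).2 h'
    exact Prod.ext (congrArg Nat.cast h2) (congrArg Nat.cast h1)
  let ρ : ℕ → ℝ := fun k => min (ψ k) 1
  have hρ0 : ∀ k, 0 < ρ k := fun k => lt_min (hψ k) one_pos
  let E : (Σ k : ℕ, {a // a ∈ (Finset.range k).filter k.Coprime}) →
      Set (UnitAddCircle × UnitAddCircle) :=
    fun i => torusChar (vec i) ⁻¹' Metric.closedBall 0 (ρ i.1 / 2)
  have hEmeas : ∀ i, MeasurableSet (E i) := fun i =>
    (continuous_torusChar _).measurable measurableSet_closedBall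
  have hEvol : ∀ i, ((volume : Measure UnitAddCircle).prod volume).real (E i) = ρ i.1 := fun i => by
    rw [measureReal_def, measure_torusChar_norm_le (hvec0 i), mul_div_cancel₀ _ two_ne_zero,
      min_eq_right (min_le_right _ _), ENNReal.toReal_ofReal (hρ0 _).le]
  have hind : Pairwise fun i j => IndepFun ((E i).indicator (1 : UnitAddCircle × UnitAddCircle → ℝ))
      ((E j).indicator (1 : UnitAddCircle × UnitAddCircle → ℝ))
      ((volume : Measure UnitAddCircle).prod volume) := by
    intro i j hij
    exact (indepFun_torusChar (hdet i j hij)).comp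
      (φ := (Metric.closedBall 0 (ρ i.1 / 2)).indicator 1)
      (ψ := (Metric.closedBall 0 (ρ j.1 / 2)).indicator 1)
      (measurable_one.indicator measurableSet_closedBall)
      (measurable_one.indicator measurableSet_closedBall)
  have hdiv : ¬ Summable fun i => ((volume : Measure UnitAddCircle).prod volume).real (E i) := by
    intro h
    simp only [hEvol] at h
    refine not_summable_nat_mul_min hanti one_pos hs
      (summable_nat_mul_of_summable_totient_mul (hanti.min antitone_const) (fun k => (hρ0 k).le) ?_)
    refine h.sigma.congr fun k => ?_
    rw [tsum_fintype]
    simp [Nat.totient, ρ]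
  have hnull := measure_setOf_finite_eq_zero_of_pairwise_indepFun_indicator hEmeas hind hdiv
  filter_upwards [measure_eq_zero_iff_ae_notMem.1 hnull] with x hx
  have hx' : {i | x ∈ E i}.Infinite := hx
  refine (hx'.image hinj.injOn).mono ?_
  rintro _ ⟨i, hi, rfl⟩
  refine ⟨hvec0 i, ?_⟩
  have hmax : max (vec i).1.natAbs (vec i).2.natAbs = i.1 := by
    simpa [vec] using (hlt i).le
  have h1 : ‖torusChar (vec i) x‖ ≤ ρ i.1 / 2 := mem_closedBall_zero_iff.1 hi
  have h2 : ρ i.1 ≤ ψ i.1 := min_le_left _ _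
  rw [hmax]
  linarith [hρ0 i.1]

theorem measurePreserving_coe_prod :
    MeasurePreserving (Prod.map ((↑) : ℝ → UnitAddCircle) ((↑) : ℝ → UnitAddCircle))
      ((volume : Measure (ℝ × ℝ)).restrict (Icc 0 1 ×ˢ Icc 0 1))
      ((volume : Measure UnitAddCircle).prod volume) := by
  have h : MeasurePreserving ((↑) : ℝ → UnitAddCircle) (volume.restrict (Icc 0 1)) volume := by
    have := UnitAddCircle.measurePreserving_mk 0
    rwa [zero_add, restrict_Ioc_eq_restrict_Icc] at this
  rw [Measure.volume_eq_prod, ← Measure.prod_restrict]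
  exact h.prod h

theorem mem_W2_iff {ψ : ℕ → ℝ} {u : ℝ × ℝ} :
    u ∈ W2 ψ ↔ u ∈ (Icc 0 1 ×ˢ Icc 0 1 : Set (ℝ × ℝ)) ∧
      (approxVectors ψ
        (Prod.map ((↑) : ℝ → UnitAddCircle) ((↑) : ℝ → UnitAddCircle) u)).Infinite := by
  have h : ∀ q : ℤ × ℤ, nint ((q.1 : ℝ) * u.1 + (q.2 : ℝ) * u.2) =
      ‖torusChar q (Prod.map ((↑) : ℝ → UnitAddCircle) ((↑) : ℝ → UnitAddCircle) u)‖ := fun q => by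
    rw [nint_eq_norm, torusChar_apply]
    simp only [Prod.map_fst, Prod.map_snd, ← AddCircle.coe_zsmul, ← AddCircle.coe_add, zsmul_eq_mul]
  unfold W2 approxVectors
  simp only [h, Set.mem_ofPred_eq, Set.mem_prod, and_assoc]

/-- **Planar Groshev theorem (dual form)**: `W(ψ)` has planar Lebesgue measure
`0` if `∑ k ψ(k) < ∞`, and measure `1` if `∑ k ψ(k) = ∞` and `ψ` is
non-increasing. -/
theorem planar_groshev (ψ : ℕ → ℝ) (hψ : ∀ k, 0 < ψ k) :
    ((Summable fun k : ℕ => (k : ℝ) * ψ k) → volume (W2 ψ) = 0) ∧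
    ((¬ Summable fun k : ℕ => (k : ℝ) * ψ k) → Antitone ψ →
      volume (W2 ψ) = 1) := by
  have hsub : W2 ψ ⊆ Icc 0 1 ×ˢ Icc 0 1 := fun u hu => (mem_W2_iff.1 hu).1
  rw [← Measure.restrict_eq_self volume hsub]
  constructor
  · intro hs
    rw [measure_eq_zero_iff_ae_notMem]
    filter_upwards [measurePreserving_coe_prod.quasiMeasurePreserving.ae
      (ae_finite_approxVectors (fun k => (hψ k).le) hs)] with u hu hmem
    exact (mem_W2_iff.1 hmem).2 hu
  · intro hs hanti
    have hae : W2 ψ =ᵐ[volume.restrict (Icc 0 1 ×ˢ Icc 0 1)] univ := by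
      rw [Filter.eventuallyEq_univ]
      filter_upwards [measurePreserving_coe_prod.quasiMeasurePreserving.ae
        (ae_infinite_approxVectors hψ hs hanti),
        ae_restrict_mem (measurableSet_Icc.prod measurableSet_Icc)] with u hu hmem
      exact mem_W2_iff.2 ⟨hmem, hu⟩
    rw [measure_congr hae, Measure.restrict_apply_univ, Measure.volume_eq_prod, Measure.prod_prod]
    simp
end

section
/- Let m, n ≥ 1 and v > m/n, and let W_v := {X ∈ [0,1]^{m×n} : ‖qX‖ < |q|^{-v} for infinitely many q ∈ ℤ^m \ {0}}. Then the Hausdorff dimension of W_v satisfies dim W_v ≤ (m-1)n + (m+n)/(v+1). -/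
open MeasureTheory Set

/-- The set `W_v` of `v`-approximable `m × n` matrices in the unit cube:
`‖qX‖ < |q|^{-v}` for infinitely many nonzero `q ∈ ℤᵐ`. -/
noncomputable def Wv (m n : ℕ) (v : ℝ) : Set (Fin m → Fin n → ℝ) :=
  {X | (∀ i j, X i j ∈ Icc (0 : ℝ) 1) ∧
    {q : Fin m → ℤ | q ≠ 0 ∧
      supNint (fun j => ∑ i, (q i : ℝ) * X i j) < (supNorm q : ℝ) ^ (-v)}.Infinite}

open Filter Topology Metric in
/-- **Hausdorff–Cantelli lemma**: if the sum of the `d`-th powers of the diameters of a countable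
family converges, then the set of points lying in infinitely many members is `μH[d]`-null. -/
lemma hausdorffMeasure_eq_zero_of_infinite_mem {X ι : Type*} [EMetricSpace X] [MeasurableSpace X]
    [BorelSpace X] [Countable ι] {d : ℝ} (hd : 0 < d) (U : ι → Set X) (S : Set X)
    (hsum : ∑' i, ediam (U i) ^ d ≠ ⊤) (hS : ∀ x ∈ S, {i | x ∈ U i}.Infinite) :
    μH[d] S = 0 := by
  have htail := ENNReal.tendsto_tsum_compl_atTop_zero hsum
  have hle := Measure.hausdorffMeasure_le_liminf_tsum (β := Finset ι)
    (ι := fun F => {i // i ∉ F}) d S (l := atTop)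
    (fun F => (∑' i : {i // i ∉ F}, ediam (U i) ^ d) ^ d⁻¹)
    (by simpa [ENNReal.zero_rpow_of_pos (inv_pos.2 hd)] using htail.ennrpow_const d⁻¹)
    (fun F i => U i)
    (Eventually.of_forall fun F i => by
      rw [ENNReal.le_rpow_inv_iff hd]
      exact ENNReal.le_tsum (f := fun i : {i // i ∉ F} => ediam (U i) ^ d) i)
    (Eventually.of_forall fun F x hx => by
      obtain ⟨i, hi, hiF⟩ := (hS x hx).exists_notMem_finset F
      exact mem_iUnion.2 ⟨⟨i, hiF⟩, hi⟩)
  rw [htail.liminf_eq] at hle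
  exact le_antisymm hle bot_le

/-- A variant of the Hausdorff–Cantelli lemma for a sequence of finite families, where all members
of the `i`-th family have diameter at most `δ i`. -/
lemma hausdorffMeasure_eq_zero_of_infinite_mem_finite {X ι : Type*} [EMetricSpace X]
    [MeasurableSpace X] [BorelSpace X] [Countable ι] {κ : ι → Type*} [∀ i, Fintype (κ i)]
    {d : ℝ} (hd : 0 < d) (U : ∀ i, κ i → Set X) (S : Set X) (δ c : ι → ℝ)
    (hδ : ∀ i, 0 ≤ δ i)
    (hdiam : ∀ i k, Metric.ediam (U i k) ≤ ENNReal.ofReal (δ i))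
    (hc : ∀ i, (Fintype.card (κ i) : ℝ) * δ i ^ d ≤ c i) (hsum : Summable c)
    (hS : ∀ x ∈ S, {i | ∃ k, x ∈ U i k}.Infinite) :
    μH[d] S = 0 := by
  refine hausdorffMeasure_eq_zero_of_infinite_mem hd (fun z : Sigma κ => U z.1 z.2) S ?_ ?_
  · rw [ENNReal.tsum_sigma']
    refine ne_top_of_le_ne_top hsum.tsum_ofReal_ne_top (ENNReal.tsum_le_tsum fun i => ?_)
    calc ∑' k, Metric.ediam (U i k) ^ d ≤ ∑' _ : κ i, ENNReal.ofReal (δ i) ^ d :=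
          ENNReal.tsum_le_tsum fun k => ENNReal.rpow_le_rpow (hdiam i k) hd.le
      _ = ENNReal.ofReal ((Fintype.card (κ i) : ℝ) * δ i ^ d) := by
          rw [tsum_fintype, Finset.sum_const, nsmul_eq_mul, Finset.card_univ,
            ENNReal.ofReal_mul (by positivity), ENNReal.ofReal_natCast,
            ENNReal.ofReal_rpow_of_nonneg (hδ i) hd.le]
      _ ≤ _ := ENNReal.ofReal_le_ofReal (hc i)
  · intro x hx
    refine Set.Infinite.of_image Sigma.fst ((hS x hx).mono ?_)
    rintro i ⟨k, hk⟩
    exact ⟨⟨i, k⟩, hk, rfl⟩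

lemma exists_natAbs_eq_supNorm {m : ℕ} (hm : 1 ≤ m) (q : Fin m → ℤ) :
    ∃ i, (q i).natAbs = supNorm q := by
  obtain ⟨i, -, hi⟩ := Finset.exists_mem_eq_sup Finset.univ
    ⟨(⟨0, hm⟩ : Fin m), Finset.mem_univ _⟩ fun i => (q i).natAbs
  exact ⟨i, hi.symm⟩

lemma abs_le_supNorm {m : ℕ} (q : Fin m → ℤ) (i : Fin m) : |(q i : ℝ)| ≤ supNorm q := by
  rw [← Int.cast_abs, Int.abs_eq_natAbs, Int.cast_natCast]
  exact_mod_cast Finset.le_sup (f := fun i => (q i).natAbs) (Finset.mem_univ i)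

lemma one_le_supNorm {m : ℕ} {q : Fin m → ℤ} (hq : q ≠ 0) : 1 ≤ supNorm q := by
  obtain ⟨i, hi⟩ := Function.ne_iff.1 hq
  exact (Int.natAbs_pos.2 hi).trans_le
    (Finset.le_sup (f := fun i => (q i).natAbs) (Finset.mem_univ i))

lemma supNorm_eq_norm {m : ℕ} (q : Fin m → ℤ) : (supNorm q : ℝ) = ‖fun i => (q i : ℝ)‖ := by
  rcases Nat.eq_zero_or_pos m with rfl | hm
  · simp [supNorm, Pi.norm_def]
  refine le_antisymm ?_ ((pi_norm_le_iff_of_nonneg (Nat.cast_nonneg _)).2 fun i => ?_)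
  · obtain ⟨i, hi⟩ := exists_natAbs_eq_supNorm hm q
    rw [← hi, Nat.cast_natAbs, Int.cast_abs]
    exact norm_le_pi_norm (fun i => (q i : ℝ)) i
  · exact abs_le_supNorm q i

lemma summable_supNorm_rpow (m : ℕ) {r : ℝ} (hr : r < -m) :
    Summable fun q : Fin m → ℤ => (supNorm q : ℝ) ^ r := by
  let b := Pi.basisFun ℝ (Fin m)
  let L := Submodule.span ℤ (Set.range b)
  have hrank : Module.finrank ℤ L = m := by
    rw [ZLattice.rank ℝ L, Module.finrank_fin_fun]
  have hmem (q : Fin m → ℤ) : (fun i => (q i : ℝ)) ∈ L := by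
    rw [b.mem_span_iff_repr_mem ℤ]
    exact fun i => ⟨q i, by simp [b]⟩
  have hinj : Function.Injective fun q : Fin m → ℤ => (⟨_, hmem q⟩ : L) := fun q q' h => by
    funext i
    exact Int.cast_injective (congrFun (congrArg Subtype.val h) i)
  refine ((ZLattice.summable_norm_rpow L r (by rwa [hrank])).comp_injective hinj).congr fun q => ?_
  simp [supNorm_eq_norm]

lemma exists_int_abs_sub_lt_of_supNint_lt {n : ℕ} {u : Fin n → ℝ} {ε : ℝ} (h : supNint u < ε)
    (j : Fin n) : ∃ p : ℤ, |u j - p| < ε :=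
  exists_lt_of_ciInf_lt ((le_ciSup (Set.finite_range fun j => nint (u j)).bddAbove j).trans_lt h)

/-- The matrices whose rows other than the `i₀`-th lie in the cell of side `K⁻¹` indexed by `a`,
and for which `qX` is within `ε` of `p`. -/
def linearFormCell {m n : ℕ} (q : Fin m → ℤ) (i₀ : Fin m) (K : ℕ) (ε : ℝ)
    (a : {i // i ≠ i₀} → Fin n → ℕ) (p : Fin n → ℤ) : Set (Fin m → Fin n → ℝ) :=
  {X | (∀ i j, (a i j : ℝ) ≤ K * X i j ∧ K * X i j ≤ a i j + 1) ∧
    ∀ j, |∑ i, (q i : ℝ) * X i j - p j| < ε}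

lemma ediam_linearFormCell_le {m n : ℕ} (q : Fin m → ℤ) (i₀ : Fin m)
    (hi₀ : (q i₀).natAbs = supNorm q) (hq : q ≠ 0) {K : ℕ} {η : ℝ} (hη : 0 < η)
    (hK : η⁻¹ ≤ K) (a : {i // i ≠ i₀} → Fin n → ℕ) (p : Fin n → ℤ) :
    Metric.ediam (linearFormCell q i₀ K (supNorm q * η) a p) ≤
      ENNReal.ofReal ((m + 2) * η) := by
  have hN : (1 : ℝ) ≤ supNorm q := by exact_mod_cast one_le_supNorm hq
  have hK0 : (0 : ℝ) < K := (inv_pos.2 hη).trans_le hK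
  refine Metric.ediam_le fun X hX Y hY => ?_
  rw [edist_dist]
  refine ENNReal.ofReal_le_ofReal ?_
  have hrow (i : Fin m) (hi : i ≠ i₀) (j : Fin n) : |X i j - Y i j| ≤ η := by
    have h1 := hX.1 ⟨i, hi⟩ j
    have h2 := hY.1 ⟨i, hi⟩ j
    have h3 : K * |X i j - Y i j| ≤ 1 := by
      rw [← Nat.abs_cast K, ← abs_mul, abs_le]
      constructor <;> linarith [h1.1, h1.2, h2.1, h2.2]
    have h4 : 1 ≤ K * η := by rwa [inv_le_iff_one_le_mul₀ hη] at hK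
    exact le_of_mul_le_mul_left (h3.trans h4) hK0
  refine (dist_pi_le_iff (by positivity)).2 fun i => (dist_pi_le_iff (by positivity)).2 fun j => ?_
  rw [Real.dist_eq]
  by_cases hi : i = i₀
  · subst hi
    have hqi : |(q i : ℝ)| = supNorm q := by
      rw [← hi₀, Nat.cast_natAbs, Int.cast_abs]
    have hsplit : (q i : ℝ) * (X i j - Y i j) =
        (∑ k, (q k : ℝ) * X k j - p j) - (∑ k, (q k : ℝ) * Y k j - p j) -
          ∑ k ∈ Finset.univ.erase i, (q k : ℝ) * (X k j - Y k j) := by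
      have h := Finset.add_sum_erase Finset.univ (fun k => (q k : ℝ) * (X k j - Y k j))
        (Finset.mem_univ i)
      have h' : ∑ k, (q k : ℝ) * (X k j - Y k j) =
          ∑ k, (q k : ℝ) * X k j - ∑ k, (q k : ℝ) * Y k j := by
        simp [mul_sub, Finset.sum_sub_distrib]
      linarith
    have hsum : |∑ k ∈ Finset.univ.erase i, (q k : ℝ) * (X k j - Y k j)| ≤
        m * (supNorm q * η) := by
      refine (Finset.abs_sum_le_sum_abs _ _).trans ?_
      refine (Finset.sum_le_card_nsmul _ _ (supNorm q * η) fun k hk => ?_).trans ?_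
      · rw [abs_mul]
        exact mul_le_mul (abs_le_supNorm q k) (hrow k (Finset.ne_of_mem_erase hk) j)
          (abs_nonneg _) (Nat.cast_nonneg _)
      · rw [nsmul_eq_mul]
        refine mul_le_mul_of_nonneg_right ?_ (by positivity)
        exact_mod_cast (Finset.card_le_univ _).trans (Fintype.card_fin m).le
    have hmul : supNorm q * |X i j - Y i j| ≤ supNorm q * ((m + 2) * η) := by
      rw [← hqi, ← abs_mul, hqi, hsplit]
      have h1 := abs_lt.1 (hX.2 j)
      have h2 := abs_lt.1 (hY.2 j)
      have h3 := abs_le.1 hsum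
      rw [abs_le]
      constructor <;> linarith [h1.1, h1.2, h2.1, h2.2, h3.1, h3.2]
    exact le_of_mul_le_mul_left hmul (by linarith)
  · refine (hrow i hi j).trans ?_
    have : (0 : ℝ) ≤ m := Nat.cast_nonneg m
    nlinarith

lemma exists_mem_linearFormCell {m n : ℕ} (q : Fin m → ℤ) (i₀ : Fin m) (K : ℕ) {ε : ℝ}
    (hε : ε ≤ 1) {X : Fin m → Fin n → ℝ} (hX : ∀ i j, X i j ∈ Icc (0 : ℝ) 1)
    (h : supNint (fun j => ∑ i, (q i : ℝ) * X i j) < ε) :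
    ∃ (a : {i // i ≠ i₀} → Fin n → Fin (K + 1))
      (p : Fin n → Finset.Icc (-(m * supNorm q + 1 : ℤ)) (m * supNorm q + 1)),
      X ∈ linearFormCell q i₀ K ε (fun i j => a i j) (fun j => p j) := by
  choose p hp using fun j => exists_int_abs_sub_lt_of_supNint_lt h j
  have hp_mem (j : Fin n) :
      p j ∈ Finset.Icc (-(m * supNorm q + 1 : ℤ)) (m * supNorm q + 1) := by
    have hsum : |∑ i, (q i : ℝ) * X i j| ≤ m * supNorm q := by
      refine (Finset.abs_sum_le_sum_abs _ _).trans ?_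
      refine (Finset.sum_le_card_nsmul _ _ (supNorm q : ℝ) fun k _ => ?_).trans ?_
      · rw [abs_mul, abs_of_nonneg (hX k j).1]
        exact (mul_le_of_le_one_right (abs_nonneg _) (hX k j).2).trans (abs_le_supNorm q k)
      · simp
    have h1 := abs_lt.1 (hp j)
    have h2 := abs_le.1 hsum
    rw [Finset.mem_Icc]
    constructor
    · have : (-(m * supNorm q + 1) : ℝ) ≤ p j := by linarith [h1.2, h2.1]
      exact_mod_cast this
    · have : (p j : ℝ) ≤ m * supNorm q + 1 := by linarith [h1.1, h2.2]
      exact_mod_cast this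
  have ha (i : Fin m) (j : Fin n) : ⌊K * X i j⌋₊ < K + 1 := by
    refine Nat.lt_succ_of_le (Nat.floor_le_of_le ?_)
    exact mul_le_of_le_one_right (Nat.cast_nonneg _) (hX i j).2
  refine ⟨fun i j => ⟨_, ha i j⟩, fun j => ⟨p j, hp_mem j⟩, fun i j => ⟨?_, ?_⟩, hp⟩
  · exact Nat.floor_le (mul_nonneg (Nat.cast_nonneg _) (hX i j).1)
  · exact (Nat.lt_floor_add_one _).le

/-- The number of cells attached to `q` is `O(|q|^{(v+1)(m-1)n + n})`. -/
lemma card_linearFormCells_le {m n : ℕ} (hm : 1 ≤ m) {v : ℝ} (hv : 0 < v) {q : Fin m → ℤ}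
    (hq : q ≠ 0) (i₀ : Fin m) :
    (Fintype.card (({i // i ≠ i₀} → Fin n → Fin (⌈(supNorm q : ℝ) ^ (v + 1)⌉₊ + 1)) ×
      (Fin n → Finset.Icc (-(m * supNorm q + 1 : ℤ)) (m * supNorm q + 1))) : ℝ) ≤
      3 ^ (n * (m - 1)) * (5 * m) ^ n *
        (supNorm q : ℝ) ^ ((v + 1) * (((m : ℝ) - 1) * n) + n) := by
  have hN : (1 : ℝ) ≤ supNorm q := by exact_mod_cast one_le_supNorm hq
  have hN0 : (0 : ℝ) < supNorm q := by linarith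
  have hm' : (1 : ℝ) ≤ m := by exact_mod_cast hm
  have hK : ((⌈(supNorm q : ℝ) ^ (v + 1)⌉₊ + 1 : ℕ) : ℝ) ≤ 3 * (supNorm q : ℝ) ^ (v + 1) := by
    have h1 := (Nat.ceil_lt_add_one (Real.rpow_nonneg hN0.le (v + 1))).le
    have h2 : 1 ≤ (supNorm q : ℝ) ^ (v + 1) := Real.one_le_rpow hN (by linarith)
    push_cast
    linarith
  have hL : (((m * supNorm q + 1 + 1 - -(m * supNorm q + 1) : ℤ).toNat : ℕ) : ℝ) ≤
      5 * m * supNorm q := by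
    have h1 : ((m * supNorm q + 1 + 1 - -(m * supNorm q + 1) : ℤ).toNat : ℕ) =
        2 * (m * supNorm q) + 3 := by
      have : (0 : ℤ) ≤ m * supNorm q := by positivity
      zify
      omega
    rw [h1]
    push_cast
    nlinarith
  have hcard : Fintype.card {i // i ≠ i₀} = m - 1 := by
    rw [Fintype.card_subtype_compl]; simp
  simp only [Fintype.card_prod, Fintype.card_pi, Finset.prod_const, Finset.card_univ, hcard,
    Fintype.card_fin, Fintype.card_coe, Int.card_Icc]
  rw [Nat.cast_mul, Nat.cast_pow, Nat.cast_pow, Nat.cast_pow, ← pow_mul]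
  calc _ ≤ (3 * (supNorm q : ℝ) ^ (v + 1)) ^ (n * (m - 1)) * (5 * m * supNorm q) ^ n := by
        gcongr
    _ = _ := by
        rw [mul_pow, mul_pow _ (supNorm q : ℝ),
          Real.rpow_add hN0 _ (n : ℝ), Real.rpow_mul hN0.le, Real.rpow_natCast]
        have : ((m : ℝ) - 1) * n = ((n * (m - 1) : ℕ) : ℝ) := by
          rw [Nat.cast_mul, Nat.cast_sub hm]; push_cast; ring
        rw [this, Real.rpow_natCast]
        ring

lemma hausdorffMeasure_Wv_eq_zero {m n : ℕ} (hm : 1 ≤ m) {v s : ℝ} (hv : 0 < v)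
    (hs : ((m : ℝ) - 1) * n + (m + n) / (v + 1) < s) :
    μH[s] (Wv m n v) = 0 := by
  have hm' : (1 : ℝ) ≤ m := by exact_mod_cast hm
  have hs0 : 0 < s := lt_of_le_of_lt
    (add_nonneg (mul_nonneg (by linarith) (Nat.cast_nonneg _)) (by positivity)) hs
  have hexp : (v + 1) * (((m : ℝ) - 1) * n) + n + -(v + 1) * s < -m := by
    have h := mul_lt_mul_of_pos_left hs (by linarith : 0 < v + 1)
    rw [mul_add, mul_div_cancel₀ _ (by linarith : v + 1 ≠ 0)] at h
    linarith
  choose i₀ hi₀ using fun q : Fin m → ℤ => exists_natAbs_eq_supNorm hm q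
  refine hausdorffMeasure_eq_zero_of_infinite_mem_finite (ι := {q : Fin m → ℤ // q ≠ 0})
    (κ := fun q => ({i // i ≠ i₀ q} → Fin n → Fin (⌈(supNorm q.1 : ℝ) ^ (v + 1)⌉₊ + 1)) ×
      (Fin n → Finset.Icc (-(m * supNorm q.1 + 1 : ℤ)) (m * supNorm q.1 + 1))) hs0
    (fun q k => linearFormCell q.1 (i₀ q) ⌈(supNorm q.1 : ℝ) ^ (v + 1)⌉₊
      (supNorm q.1 * (supNorm q.1 : ℝ) ^ (-(v + 1))) (fun i j => k.1 i j) (fun j => k.2 j))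
    (Wv m n v) (fun q => (m + 2) * (supNorm q.1 : ℝ) ^ (-(v + 1)))
    (fun q => (3 ^ (n * (m - 1)) * (5 * m) ^ n * (m + 2) ^ s) *
      (supNorm q.1 : ℝ) ^ ((v + 1) * (((m : ℝ) - 1) * n) + n + -(v + 1) * s))
    (fun q => by positivity) (fun q k => ?_) (fun q => ?_)
    (((summable_supNorm_rpow m hexp).comp_injective Subtype.val_injective).mul_left _)
    fun X hX => ?_
  · have hN0 : (0 : ℝ) < supNorm q.1 := by exact_mod_cast one_le_supNorm q.2
    refine ediam_linearFormCell_le q.1 _ (hi₀ q) q.2 (Real.rpow_pos_of_pos hN0 _) ?_ _ _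
    rw [Real.rpow_neg hN0.le, inv_inv]
    exact Nat.le_ceil _
  · have hN0 : (0 : ℝ) < supNorm q.1 := by exact_mod_cast one_le_supNorm q.2
    refine (mul_le_mul_of_nonneg_right (card_linearFormCells_le hm hv q.2 (i₀ q))
      (by positivity)).trans_eq ?_
    rw [Real.mul_rpow (by positivity) (by positivity), ← Real.rpow_mul hN0.le,
      Real.rpow_add hN0 _ (-(v + 1) * s)]
    ring
  · refine Set.Infinite.of_image Subtype.val (hX.2.mono ?_)
    rintro q ⟨hq, hqX⟩
    have hN : (1 : ℝ) ≤ supNorm q := by exact_mod_cast one_le_supNorm hq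
    have hε : supNorm q * (supNorm q : ℝ) ^ (-(v + 1)) = (supNorm q : ℝ) ^ (-v) := by
      rw [mul_comm, ← Real.rpow_add_one (by linarith)]
      congr 1
      ring
    rw [← hε] at hqX
    obtain ⟨a, p, h⟩ := exists_mem_linearFormCell q (i₀ q) ⌈(supNorm q : ℝ) ^ (v + 1)⌉₊
      (hε.trans_le (Real.rpow_le_one_of_one_le_of_nonpos hN (by linarith))) hX.1 hqX
    exact ⟨⟨q, hq⟩, ⟨(a, p), h⟩, rfl⟩

/-- **Upper bound in the Jarník–Besicovitch theorem for linear forms**: for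
`v > m/n`, the Hausdorff dimension of `W_v` is at most
`(m-1)n + (m+n)/(v+1)`. -/
theorem dimH_Wv_upper (m n : ℕ) (hm : 1 ≤ m) (hn : 1 ≤ n) (v : ℝ)
    (hv : (m : ℝ) / (n : ℝ) < v) :
    dimH (Wv m n v) ≤
      ENNReal.ofReal (((m : ℝ) - 1) * (n : ℝ) + ((m : ℝ) + (n : ℝ)) / (v + 1)) := by
  have hv0 : 0 < v := lt_of_le_of_lt (by positivity) hv
  refine dimH_le fun d hd => ?_
  by_contra! hlt
  rw [← ENNReal.ofReal_coe_nnreal] at hlt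
  have h := hausdorffMeasure_Wv_eq_zero hm hv0 (ENNReal.ofReal_lt_ofReal_iff'.1 hlt).1
  rw [h] at hd
  exact ENNReal.zero_ne_top hd
end
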